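/- arXiv:2507.07200 — 2 statements merged into one kernel-verified Lean document; each statement's English description precedes it below -/
import Mathlib

section
/- (Barycentric weak transport duality) Let θ : ℝ^d → [0,∞) be convex and let μ, ν ∈ P₁(ℝ^d). Then inf_{π ∈ Π(μ,ν)} ∫_{ℝ^d} θ(x − mean(π_x)) dμ(x) = sup { ∫ ψ^C dμ − ∫ ψ dν : ψ ∈ C_{b,1}(ℝ^d), ψ convex }, where ψ^C(x) = inf_{z ∈ ℝ^d} ( ψ(z) + θ(x − z) ). -/
open MeasureTheory Set Filter Topology
open scoped ENNReal

noncomputable section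

/-- `ℝ^d`, modelled as Euclidean space. -/
abbrev Rd (d : ℕ) : Type := EuclideanSpace ℝ (Fin d)

/-- A Borel measure on `ℝ^d` has finite `p`-th moment. -/
def HasMomentP (p : ℝ) {d : ℕ} (ρ : Measure (Rd d)) : Prop :=
  ∫⁻ y, ENNReal.ofReal (‖y‖ ^ p) ∂ρ ≠ ⊤

/-- `P_p(ℝ^d)`: Borel probability measures on `ℝ^d` with finite `p`-th moment. -/
abbrev Pp (p : ℝ) (d : ℕ) : Type :=
  {ρ : Measure (Rd d) // IsProbabilityMeasure ρ ∧ HasMomentP p ρ}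

/-- Continuous test functions of growth of order at most `p`. -/
def GrowthP (p : ℝ) {d : ℕ} (f : Rd d → ℝ) : Prop :=
  Continuous f ∧ ∃ K : ℝ, ∀ y, |f y| ≤ K * (1 + ‖y‖ ^ p)

/-- The `p`-weak topology on `P_p(ℝ^d)`: the initial topology induced by integration
against continuous functions of growth of order at most `p`. -/
instance PpTopology (p : ℝ) (d : ℕ) : TopologicalSpace (Pp p d) :=
  ⨅ f : {f : Rd d → ℝ // GrowthP p f},
    TopologicalSpace.induced (fun ρ : Pp p d => ∫ y, f.1 y ∂ρ.1) inferInstance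

instance PpMeasurableSpace (p : ℝ) (d : ℕ) : MeasurableSpace (Pp p d) := borel _

/-- `C_{b,p}(ℝ^d)`: continuous functions bounded from below by a constant and bounded
above by `K (1 + |y - y₀|^p)` for some `K > 0`, `y₀`. -/
def Cbp (p : ℝ) {d : ℕ} (ψ : Rd d → ℝ) : Prop :=
  Continuous ψ ∧ (∃ c : ℝ, ∀ y, c ≤ ψ y) ∧
    ∃ K : ℝ, 0 < K ∧ ∃ y₀ : Rd d, ∀ y, ψ y ≤ K * (1 + ‖y - y₀‖ ^ p)

open scoped Classical in
/-- The nonnegative part of an extended real, as an extended nonnegative real. -/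
def erealToENN (x : EReal) : ℝ≥0∞ := if x = ⊤ then ⊤ else ENNReal.ofReal x.toReal

/-- Canonical extended integral of an `EReal`-valued function: the lower integral of the
positive part minus the lower integral of the negative part. -/
def eInt {α : Type*} [MeasurableSpace α] (μ : Measure α) (f : α → EReal) : EReal :=
  ((∫⁻ x, erealToENN (f x) ∂μ : ℝ≥0∞) : EReal) -
    ((∫⁻ x, erealToENN (-(f x)) ∂μ : ℝ≥0∞) : EReal)

/-- The convex order on measures on `ℝ^d`: `ρ₁ ≼_c ρ₂` iff `∫ f dρ₁ ≤ ∫ f dρ₂` for every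
convex function `f : ℝ^d → ℝ` (integrals taken in the extended sense). -/
def ConvexOrder {d : ℕ} (ρ₁ ρ₂ : Measure (Rd d)) : Prop :=
  ∀ f : Rd d → ℝ, ConvexOn ℝ univ f →
    eInt ρ₁ (fun y => (f y : EReal)) ≤ eInt ρ₂ (fun y => (f y : EReal))

/-- Coordinatewise increasing functions on `ℝ^d`. -/
def CoordMono {d : ℕ} (f : Rd d → ℝ) : Prop :=
  ∀ y z : Rd d, (∀ i, y i ≤ z i) → f y ≤ f z

/-- The increasing convex order on measures on `ℝ^d`. -/
def IcxOrder {d : ℕ} (ρ₁ ρ₂ : Measure (Rd d)) : Prop :=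
  ∀ f : Rd d → ℝ, ConvexOn ℝ univ f → CoordMono f →
    eInt ρ₁ (fun y => (f y : EReal)) ≤ eInt ρ₂ (fun y => (f y : EReal))

/-- `π` is a coupling of `μ` and `ν`. -/
def IsCoupling {X Y : Type*} [MeasurableSpace X] [MeasurableSpace Y]
    (π : Measure (X × Y)) (μ : Measure X) (ν : Measure Y) : Prop :=
  IsProbabilityMeasure π ∧ π.map Prod.fst = μ ∧ π.map Prod.snd = ν

open scoped Classical in
/-- Disintegration of a measure on a product space with respect to its first marginal. -/
def disint {X : Type*} [MeasurableSpace X] {Y : Type*} [MeasurableSpace Y]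
    [StandardBorelSpace Y] [Nonempty Y] (π : Measure (X × Y)) :
    ProbabilityTheory.Kernel X Y :=
  if h : IsFiniteMeasure π then (haveI := h; π.condKernel) else 0

/-- The primal weak optimal transport value `inf_{π ∈ Π(μ,ν)} ∫ C(x, π_x) dμ(x)`. -/
def primal {X : Type*} [MeasurableSpace X] {d : ℕ}
    (μ : Measure X) (ν : Measure (Rd d)) (C : X → Measure (Rd d) → ℝ≥0∞) : ℝ≥0∞ :=
  ⨅ π : {π : Measure (X × Rd d) // IsCoupling π μ ν}, ∫⁻ x, C x (disint π.1 x) ∂μ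

/-- The `C`-conjugate `ψ^C (x) = inf_{ρ ∈ P_p} ρ(ψ) + C(x, ρ)`. -/
def conj (p : ℝ) {X : Type*} [MeasurableSpace X] {d : ℕ}
    (C : X → Measure (Rd d) → ℝ≥0∞) (ψ : Rd d → ℝ) (x : X) : EReal :=
  ⨅ ρ : Pp p d, ((∫ y, ψ y ∂ρ.1 : ℝ) : EReal) + ((C x ρ.1 : ℝ≥0∞) : EReal)

/-- The dual value `μ(ψ^C) - ν(ψ)`. -/
def dualVal (p : ℝ) {X : Type*} [MeasurableSpace X] {d : ℕ}
    (μ : Measure X) (ν : Measure (Rd d)) (C : X → Measure (Rd d) → ℝ≥0∞)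
    (ψ : Rd d → ℝ) : EReal :=
  eInt μ (conj p C ψ) - ((∫ y, ψ y ∂ν : ℝ) : EReal)

end

lemma erealToENN_mono : Monotone erealToENN := by
  intro x y hxy
  unfold erealToENN
  by_cases hy : y = ⊤
  · simp [hy]
  have hx : x ≠ ⊤ := fun h => hy (top_le_iff.1 (h ▸ hxy))
  rw [if_neg hx, if_neg hy]
  induction x with
  | bot => simp
  | top => exact absurd rfl hx
  | coe x =>
    exact ENNReal.ofReal_le_ofReal (EReal.toReal_le_toReal hxy (EReal.coe_ne_bot x) hy)

lemma erealToENN_coe (x : ℝ) : erealToENN (x : EReal) = ENNReal.ofReal x := by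
  simp [erealToENN]

lemma eInt_mono_ae {α : Type*} [MeasurableSpace α] {μ : Measure α} {f g : α → EReal}
    (h : ∀ᵐ x ∂μ, f x ≤ g x) : eInt μ f ≤ eInt μ g := by
  refine EReal.sub_le_sub ?_ ?_ <;> refine EReal.coe_ennreal_le_coe_ennreal_iff.2 ?_
  · exact lintegral_mono_ae (h.mono fun x hx => erealToENN_mono hx)
  · exact lintegral_mono_ae (h.mono fun x hx => erealToENN_mono (EReal.neg_le_neg_iff.2 hx))

lemma eInt_coe {α : Type*} [MeasurableSpace α] {μ : Measure α} {f : α → ℝ}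
    (hf : Integrable f μ) : eInt μ (fun x => (f x : EReal)) = ((∫ x, f x ∂μ : ℝ) : EReal) := by
  have h1 : ∫⁻ x, ENNReal.ofReal (f x) ∂μ ≠ ⊤ := hf.lintegral_lt_top.ne
  have h2 : ∫⁻ x, ENNReal.ofReal (-f x) ∂μ ≠ ⊤ := hf.neg.lintegral_lt_top.ne
  rw [integral_eq_lintegral_pos_part_sub_lintegral_neg_part hf]
  simp only [eInt, ← EReal.coe_neg, erealToENN_coe, EReal.coe_sub]
  rw [EReal.coe_ennreal_toReal h1, EReal.coe_ennreal_toReal h2]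

lemma HasMomentP.integrable_norm {d : ℕ} {μ : Measure (Rd d)} (h : HasMomentP 1 μ) :
    Integrable (fun x => ‖x‖) μ := by
  refine ⟨by fun_prop, ?_⟩
  rw [hasFiniteIntegral_iff_norm]
  unfold HasMomentP at h
  simpa [lt_top_iff_ne_top] using h

/-- A Hahn–Banach theorem: a convex cone in `E × ℝ` that lies above the origin and over every
point of `E` lies above the graph of a linear functional. -/
lemma exists_linearMap_le_of_pointedCone {E : Type*} [AddCommGroup E] [Module ℝ E]
    (S : PointedCone ℝ (E × ℝ)) (h0 : ∀ r : ℝ, ((0 : E), r) ∈ S → 0 ≤ r)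
    (hS : ∀ x : E, ∃ r : ℝ, (x, r) ∈ S) :
    ∃ l : E →ₗ[ℝ] ℝ, ∀ x r, (x, r) ∈ S → l x ≤ r := by
  let f : (E × ℝ) →ₗ.[ℝ] ℝ :=
    ⟨Submodule.prod ⊥ ⊤, (LinearMap.snd ℝ E ℝ).comp (Submodule.subtype _)⟩
  have hnonneg : ∀ x : f.domain, (x : E × ℝ) ∈ S → 0 ≤ f x := by
    intro x hxS
    have hx0 : x.1 = ((0 : E), x.1.2) := Prod.ext x.2.1 rfl
    exact h0 x.1.2 (hx0 ▸ hxS)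
  have hdense : ∀ y, ∃ x : f.domain, (x : E × ℝ) + y ∈ S := by
    rintro ⟨x, s⟩
    obtain ⟨r, hr⟩ := hS x
    exact ⟨⟨((0 : E), r - s), Submodule.zero_mem _, trivial⟩, by simpa using hr⟩
  obtain ⟨g, hgf, hgS⟩ := riesz_extension S f hnonneg hdense
  refine ⟨-(g.comp (LinearMap.inl ℝ E ℝ)), fun x r hx => ?_⟩
  have h1 := hgS _ hx
  have h2 : g ((0 : E), r) = r := hgf ⟨((0 : E), r), Submodule.zero_mem _, trivial⟩
  have h3 : (x, r) = (x, 0) + ((0 : E), r) := by simp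
  rw [h3, map_add, h2] at h1
  simpa [neg_le_iff_add_nonneg'] using h1

lemma isMarkovKernel_disint {X Y : Type*} [MeasurableSpace X] [MeasurableSpace Y]
    [StandardBorelSpace Y] [Nonempty Y] (π : Measure (X × Y)) [IsFiniteMeasure π] :
    ProbabilityTheory.IsMarkovKernel (disint π) := by
  rw [disint, dif_pos ‹_›]
  infer_instance

lemma IsCoupling.compProd_disint {X Y : Type*} [MeasurableSpace X] [MeasurableSpace Y]
    [StandardBorelSpace Y] [Nonempty Y] {π : Measure (X × Y)} {μ : Measure X} {ν : Measure Y}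
    (h : IsCoupling π μ ν) : μ.compProd (disint π) = π := by
  have := h.1
  have hfin : IsFiniteMeasure π := inferInstance
  rw [disint, dif_pos hfin, ← h.2.1]
  exact π.disintegrate π.condKernel

lemma IsCoupling.integrable_fst {X Y E : Type*} [MeasurableSpace X] [MeasurableSpace Y]
    [NormedAddCommGroup E] {π : Measure (X × Y)} {μ : Measure X} {ν : Measure Y}
    (h : IsCoupling π μ ν) {f : X → E} (hf : Integrable f μ) :
    Integrable (fun z => f z.1) π := by
  rw [← h.2.1] at hf
  exact hf.comp_measurable measurable_fst

lemma IsCoupling.integrable_snd {X Y E : Type*} [MeasurableSpace X] [MeasurableSpace Y]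
    [NormedAddCommGroup E] {π : Measure (X × Y)} {μ : Measure X} {ν : Measure Y}
    (h : IsCoupling π μ ν) {f : Y → E} (hf : Integrable f ν) :
    Integrable (fun z => f z.2) π := by
  rw [← h.2.2] at hf
  exact hf.comp_measurable measurable_snd

lemma IsCoupling.integral_snd {X Y E : Type*} [MeasurableSpace X] [MeasurableSpace Y]
    [NormedAddCommGroup E] [NormedSpace ℝ E] {π : Measure (X × Y)} {μ : Measure X}
    {ν : Measure Y} (h : IsCoupling π μ ν) {f : Y → E} (hf : Integrable f ν) :
    ∫ z, f z.2 ∂π = ∫ y, f y ∂ν := by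
  rw [← h.2.2] at hf ⊢
  exact (integral_map measurable_snd.aemeasurable hf.aestronglyMeasurable).symm

lemma IsCoupling.integrable_section {X Y E : Type*} [MeasurableSpace X] [MeasurableSpace Y]
    [StandardBorelSpace Y] [Nonempty Y] [NormedAddCommGroup E]
    {π : Measure (X × Y)} {μ : Measure X} [SFinite μ] {ν : Measure Y}
    (h : IsCoupling π μ ν) {f : X × Y → E} (hf : Integrable f π) :
    ∀ᵐ x ∂μ, Integrable (fun y => f (x, y)) (disint π x) := by
  have := h.1
  have := isMarkovKernel_disint π
  rw [← h.compProd_disint] at hf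
  exact ((Measure.integrable_compProd_iff hf.aestronglyMeasurable).1 hf).1

lemma IsCoupling.integrable_integral_section {X Y E : Type*} [MeasurableSpace X]
    [MeasurableSpace Y] [StandardBorelSpace Y] [Nonempty Y] [NormedAddCommGroup E]
    [NormedSpace ℝ E] {π : Measure (X × Y)} {μ : Measure X} [SFinite μ] {ν : Measure Y}
    (h : IsCoupling π μ ν) {f : X × Y → E} (hf : Integrable f π) :
    Integrable (fun x => ∫ y, f (x, y) ∂(disint π x)) μ := by
  have := h.1
  have := isMarkovKernel_disint π
  rw [← h.compProd_disint] at hf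
  exact hf.integral_compProd

lemma IsCoupling.integral_integral_section {X Y E : Type*} [MeasurableSpace X]
    [MeasurableSpace Y] [StandardBorelSpace Y] [Nonempty Y] [NormedAddCommGroup E]
    [NormedSpace ℝ E] {π : Measure (X × Y)} {μ : Measure X} [SFinite μ]
    {ν : Measure Y} (h : IsCoupling π μ ν) {f : X × Y → E} (hf : Integrable f π) :
    ∫ x, ∫ y, f (x, y) ∂(disint π x) ∂μ = ∫ z, f z ∂π := by
  have := h.1
  have := isMarkovKernel_disint π
  have hπ := h.compProd_disint
  rw [← hπ] at hf
  rw [← Measure.integral_compProd hf, hπ]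

lemma Cbp.integrable {d : ℕ} {ψ : Rd d → ℝ} (hψ : Cbp 1 ψ) {ν : Measure (Rd d)}
    [IsFiniteMeasure ν] (hν : HasMomentP 1 ν) : Integrable ψ ν := by
  obtain ⟨hc, ⟨c, hc'⟩, K, hK, y₀, hKy⟩ := hψ
  refine Integrable.mono' (g := fun y => |c| + K * (1 + ‖y₀‖ + ‖y‖)) ?_
    hc.aestronglyMeasurable (ae_of_all _ fun y => ?_)
  · have := hν.integrable_norm
    fun_prop
  · have h1 := hKy y
    rw [Real.rpow_one] at h1
    have h2 : ‖y - y₀‖ ≤ ‖y₀‖ + ‖y‖ := by linarith [norm_sub_le y y₀]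
    have h3 : K * ‖y - y₀‖ ≤ K * (‖y₀‖ + ‖y‖) := by gcongr
    have h4 : 0 ≤ K * (1 + ‖y₀‖ + ‖y‖) := by positivity
    rw [Real.norm_eq_abs, abs_le]
    constructor
    · linarith [hc' y, neg_abs_le c]
    · linarith [abs_nonneg c]

lemma continuous_of_convexOn {d : ℕ} {f : Rd d → ℝ} (hf : ConvexOn ℝ univ f) : Continuous f :=
  continuousOn_univ.1 (hf.continuousOn isOpen_univ)

/-- Weak duality. -/
lemma dual_le_of_isCoupling {d : ℕ} {θ : Rd d → ℝ} (hθc : Continuous θ)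
    (hθ_nonneg : ∀ v, 0 ≤ θ v) {μ ν : Measure (Rd d)} [IsProbabilityMeasure μ]
    [IsProbabilityMeasure ν] (hν1 : HasMomentP 1 ν) {π : Measure (Rd d × Rd d)}
    (hπ : IsCoupling π μ ν) {ψ : Rd d → ℝ} (hψ : Cbp 1 ψ) (hψc : ConvexOn ℝ univ ψ) :
    eInt μ (fun x => ⨅ z : Rd d, ((ψ z + θ (x - z) : ℝ) : EReal)) - ((∫ y, ψ y ∂ν : ℝ) : EReal)
      ≤ ((∫⁻ x, ENNReal.ofReal (θ (x - ∫ y, y ∂(disint π x))) ∂μ : ℝ≥0∞) : EReal) := by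
  have := hπ.1
  have := isMarkovKernel_disint π
  have hψν := hψ.integrable hν1
  have hψπ := hπ.integrable_snd hψν
  have hid : Integrable (fun y : Rd d => y) ν :=
    (integrable_norm_iff (by fun_prop)).1 hν1.integrable_norm
  have hidπ := hπ.integrable_snd hid
  have hm := hπ.integrable_integral_section hidπ
  by_cases htop : ∫⁻ x, ENNReal.ofReal (θ (x - ∫ y, y ∂(disint π x))) ∂μ = ⊤
  · rw [htop]
    exact le_top
  have hθm : AEStronglyMeasurable (fun x => θ (x - ∫ y, y ∂(disint π x))) μ :=
    hθc.comp_aestronglyMeasurable (aestronglyMeasurable_id.sub hm.aestronglyMeasurable)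
  have hθi : Integrable (fun x => θ (x - ∫ y, y ∂(disint π x))) μ :=
    (lintegral_ofReal_ne_top_iff_integrable hθm (ae_of_all _ fun _ => hθ_nonneg _)).1 htop
  have hP := hπ.integrable_integral_section hψπ
  have hle : eInt μ (fun x => ⨅ z : Rd d, ((ψ z + θ (x - z) : ℝ) : EReal)) ≤
      eInt μ (fun x => ((∫ y, ψ y ∂(disint π x) + θ (x - ∫ y, y ∂(disint π x)) : ℝ) : EReal)) := by
    refine eInt_mono_ae ?_
    filter_upwards [hπ.integrable_section hψπ, hπ.integrable_section hidπ] with x hx1 hx2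
    refine (iInf_le _ (∫ y, y ∂(disint π x))).trans (EReal.coe_le_coe_iff.2 ?_)
    gcongr
    exact hψc.map_integral_le hψ.1.continuousOn isClosed_univ (by simp) hx2 hx1
  have hadd := eInt_coe (hP.add hθi)
  simp only [Pi.add_apply] at hadd
  rw [hadd, integral_add hP hθi, hπ.integral_integral_section hψπ, hπ.integral_snd hψν] at hle
  refine (EReal.sub_le_sub hle le_rfl).trans ?_
  rw [← EReal.coe_sub, add_sub_cancel_left,
    integral_eq_lintegral_of_nonneg_ae (ae_of_all _ fun _ => hθ_nonneg _) hθm,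
    EReal.coe_ennreal_toReal htop]

/-- Functions of at most linear growth on `ℝ^d × ℝ^d`. -/
def linearGrowth (d : ℕ) : Submodule ℝ (Rd d × Rd d → ℝ) where
  carrier := {Φ | ∃ K : ℝ, ∀ z, |Φ z| ≤ K * (1 + ‖z.1‖ + ‖z.2‖)}
  zero_mem' := ⟨0, fun z => by simp⟩
  add_mem' := by
    rintro Φ Ψ ⟨K, hK⟩ ⟨L, hL⟩
    refine ⟨K + L, fun z => (abs_add_le _ _).trans ?_⟩
    rw [add_mul]
    exact add_le_add (hK z) (hL z)
  smul_mem' := by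
    rintro c Φ ⟨K, hK⟩
    refine ⟨|c| * K, fun z => ?_⟩
    rw [Pi.smul_apply, smul_eq_mul, abs_mul, mul_assoc]
    exact mul_le_mul_of_nonneg_left (hK z) (abs_nonneg c)

lemma mem_linearGrowth_of_bounded {d : ℕ} {Φ : Rd d × Rd d → ℝ} {C : ℝ}
    (h : ∀ z, |Φ z| ≤ C) : Φ ∈ linearGrowth d := by
  refine ⟨C, fun z => (h z).trans ?_⟩
  have hC : 0 ≤ C := (abs_nonneg _).trans (h z)
  nlinarith [norm_nonneg z.1, norm_nonneg z.2]

lemma mem_linearGrowth_mul {d : ℕ} {Φ χ : Rd d × Rd d → ℝ} (h : Φ ∈ linearGrowth d)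
    (hχ : ∀ z, |χ z| ≤ 1) : Φ * χ ∈ linearGrowth d := by
  obtain ⟨K, hK⟩ := h
  refine ⟨K, fun z => le_trans ?_ (hK z)⟩
  rw [Pi.mul_apply, abs_mul]
  exact mul_le_of_le_one_right (abs_nonneg _) (hχ z)

/-- A continuous cutoff function, equal to one where `‖z.1‖ + ‖z.2‖ ≤ n` and to zero where
`n + 1 ≤ ‖z.1‖ + ‖z.2‖`. -/
noncomputable def cutoff {d : ℕ} (n : ℕ) (z : Rd d × Rd d) : ℝ :=
  max 0 (min 1 (n + 1 - (‖z.1‖ + ‖z.2‖)))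

lemma continuous_cutoff {d : ℕ} (n : ℕ) : Continuous (cutoff (d := d) n) := by
  unfold cutoff
  fun_prop

lemma cutoff_nonneg {d : ℕ} (n : ℕ) (z : Rd d × Rd d) : 0 ≤ cutoff n z := le_max_left _ _

lemma cutoff_le_one {d : ℕ} (n : ℕ) (z : Rd d × Rd d) : cutoff n z ≤ 1 :=
  max_le zero_le_one (min_le_left _ _)

lemma abs_cutoff_le_one {d : ℕ} (n : ℕ) (z : Rd d × Rd d) : |cutoff n z| ≤ 1 := by
  rw [abs_of_nonneg (cutoff_nonneg n z)]
  exact cutoff_le_one n z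

lemma cutoff_eq_one {d : ℕ} {n : ℕ} {z : Rd d × Rd d} (h : ‖z.1‖ + ‖z.2‖ ≤ n) :
    cutoff n z = 1 := by
  rw [cutoff, min_eq_left (by linarith), max_eq_right zero_le_one]

lemma hasCompactSupport_cutoff {d : ℕ} (n : ℕ) : HasCompactSupport (cutoff (d := d) n) := by
  refine HasCompactSupport.intro (isCompact_closedBall (0 : Rd d × Rd d) (n + 1)) fun z hz => ?_
  have h1 : (n : ℝ) + 1 < ‖z‖ := by simpa using hz
  have h2 : ‖z‖ ≤ ‖z.1‖ + ‖z.2‖ := max_le (by simp) (by simp)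
  exact max_eq_left ((min_le_right _ _).trans (by linarith))

lemma tendsto_cutoff {d : ℕ} (z : Rd d × Rd d) :
    Tendsto (fun n => cutoff n z) atTop (𝓝 1) := by
  refine tendsto_const_nhds.congr' ?_
  filter_upwards [tendsto_natCast_atTop_atTop.eventually_ge_atTop (‖z.1‖ + ‖z.2‖)] with n hn
  exact (cutoff_eq_one hn).symm

/-- The part of `1 + 2 ‖x‖` that lies in the region `n < 2 ‖x‖`. -/
noncomputable def normTail {d : ℕ} (n : ℕ) (x : Rd d) : ℝ :=
  {x : Rd d | (n : ℝ) < 2 * ‖x‖}.indicator (fun x => 1 + 2 * ‖x‖) x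

lemma measurableSet_lt_two_mul_norm {d : ℕ} (n : ℕ) :
    MeasurableSet {x : Rd d | (n : ℝ) < 2 * ‖x‖} :=
  measurableSet_lt measurable_const (by fun_prop)

lemma normTail_nonneg {d : ℕ} (n : ℕ) (x : Rd d) : 0 ≤ normTail n x :=
  indicator_nonneg (fun _ _ => by positivity) x

lemma integrable_normTail {d : ℕ} {μ : Measure (Rd d)} [IsFiniteMeasure μ]
    (hμ : HasMomentP 1 μ) (n : ℕ) : Integrable (normTail n) μ := by
  have := hμ.integrable_norm
  exact Integrable.indicator (by fun_prop) (measurableSet_lt_two_mul_norm n)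

lemma tendsto_integral_normTail {d : ℕ} {μ : Measure (Rd d)} [IsFiniteMeasure μ]
    (hμ : HasMomentP 1 μ) : Tendsto (fun n => ∫ x, normTail n x ∂μ) atTop (𝓝 0) := by
  have hi := hμ.integrable_norm
  rw [← integral_zero (Rd d) ℝ (μ := μ)]
  refine tendsto_integral_of_dominated_convergence (fun x => 1 + 2 * ‖x‖)
    (fun n => (integrable_normTail hμ n).aestronglyMeasurable) (by fun_prop)
    (fun n => ae_of_all _ fun x => ?_) (ae_of_all _ fun x => ?_)
  · rw [Real.norm_of_nonneg (normTail_nonneg n x)]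
    exact indicator_le_self' (fun _ _ => by positivity) x
  · refine tendsto_const_nhds.congr' ?_
    filter_upwards [tendsto_natCast_atTop_atTop.eventually_ge_atTop (2 * ‖x‖)] with n hn
    exact (indicator_of_notMem (by simpa using hn) _).symm

lemma mul_one_sub_cutoff_le {d : ℕ} (n : ℕ) (z : Rd d × Rd d) :
    (1 + ‖z.1‖ + ‖z.2‖) * (1 - cutoff n z) ≤ normTail n z.1 + normTail n z.2 := by
  rcases le_or_gt (‖z.1‖ + ‖z.2‖) n with h | h
  · rw [cutoff_eq_one h, sub_self, mul_zero]
    exact add_nonneg (normTail_nonneg _ _) (normTail_nonneg _ _)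
  · have h0 : (1 + ‖z.1‖ + ‖z.2‖) * (1 - cutoff n z) ≤ 1 + ‖z.1‖ + ‖z.2‖ :=
      mul_le_of_le_one_right (by positivity) (by linarith [cutoff_nonneg n z])
    refine h0.trans ?_
    have h1 := normTail_nonneg n z.1
    have h2 := normTail_nonneg n z.2
    rcases le_total ‖z.1‖ ‖z.2‖ with h' | h'
    · have : normTail n z.2 = 1 + 2 * ‖z.2‖ :=
        indicator_of_mem (show (n : ℝ) < 2 * ‖z.2‖ by linarith) _
      linarith
    · have : normTail n z.1 = 1 + 2 * ‖z.1‖ :=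
        indicator_of_mem (show (n : ℝ) < 2 * ‖z.1‖ by linarith) _
      linarith

open scoped CompactlySupported in
/-- Compactly supported continuous functions have linear growth. -/
def compactlySupportedToLinearGrowth (d : ℕ) : C_c(Rd d × Rd d, ℝ) →ₗ[ℝ] linearGrowth d where
  toFun f := ⟨f, by
    obtain ⟨C, hC⟩ := f.hasCompactSupport.exists_bound_of_continuous f.continuous
    exact mem_linearGrowth_of_bounded hC⟩
  map_add' _ _ := rfl
  map_smul' _ _ := rfl

/-- A linear functional on functions of linear growth that is dominated by integration against
`μ` and `ν` is, on continuous functions, integration against a coupling of `μ` and `ν`. -/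
lemma exists_isCoupling_integral_eq {d : ℕ} {μ ν : Measure (Rd d)}
    [IsProbabilityMeasure μ] [IsProbabilityMeasure ν]
    (hμ1 : HasMomentP 1 μ) (hν1 : HasMomentP 1 ν) (l : linearGrowth d →ₗ[ℝ] ℝ)
    (hl : ∀ (Φ : linearGrowth d) (f ψ : Rd d → ℝ), Integrable f μ → Integrable ψ ν →
      (∀ z, Φ.1 z ≤ f z.1 + ψ z.2) → l Φ ≤ ∫ x, f x ∂μ + ∫ y, ψ y ∂ν) :
    ∃ π, IsCoupling π μ ν ∧
      ∀ Φ : linearGrowth d, Continuous Φ.1 → ∫ z, Φ.1 z ∂π = l Φ := by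
  have hpos : ∀ Φ : linearGrowth d, (∀ z, 0 ≤ Φ.1 z) → 0 ≤ l Φ := fun Φ hΦ => by
    have := hl (-Φ) 0 0 (integrable_zero _ _ _) (integrable_zero _ _ _) fun z => by
      simpa using hΦ z
    simpa using this
  let Λ := PositiveLinearMap.mk₀ (l.comp (compactlySupportedToLinearGrowth d))
    (fun f hf => hpos _ (CompactlySupportedContinuousMap.le_def.1 hf))
  let π := RealRMK.rieszMeasure Λ
  let trunc (Φ : linearGrowth d) (n : ℕ) : linearGrowth d :=
    ⟨Φ.1 * cutoff n, mem_linearGrowth_mul Φ.2 (abs_cutoff_le_one n)⟩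
  have hcs (Φ : linearGrowth d) (n : ℕ) : HasCompactSupport (Φ.1 * cutoff n) :=
    (hasCompactSupport_cutoff n).mul_left
  have hcont (Φ : linearGrowth d) (hΦ : Continuous Φ.1) (n : ℕ) :
      Continuous (Φ.1 * cutoff n) := hΦ.mul (continuous_cutoff n)
  have hint (Φ : linearGrowth d) (hΦ : Continuous Φ.1) (n : ℕ) :
      Integrable (Φ.1 * cutoff n) π :=
    (hcont Φ hΦ n).integrable_of_hasCompactSupport (hcs Φ n)
  have hrep (Φ : linearGrowth d) (hΦ : Continuous Φ.1) (n : ℕ) :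
      ∫ z, (Φ.1 * cutoff n : Rd d × Rd d → ℝ) z ∂π = l (trunc Φ n) :=
    RealRMK.integral_rieszMeasure Λ ⟨⟨Φ.1 * cutoff n, hcont Φ hΦ n⟩, hcs Φ n⟩
  have hlim (Φ : linearGrowth d) : Tendsto (fun n => l (trunc Φ n)) atTop (𝓝 (l Φ)) := by
    obtain ⟨K, hK⟩ := Φ.2
    have hK0 : 0 ≤ K := by simpa using (abs_nonneg _).trans (hK 0)
    have hT : Tendsto (fun n => K * (∫ x, normTail n x ∂μ + ∫ y, normTail n y ∂ν))
        atTop (𝓝 0) := by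
      simpa using ((tendsto_integral_normTail hμ1).add (tendsto_integral_normTail hν1)).const_mul K
    have key (n : ℕ) (Ψ : linearGrowth d) (hΨ : ∀ z, Ψ.1 z ≤ |Φ.1 z| * (1 - cutoff n z)) :
        l Ψ ≤ K * (∫ x, normTail n x ∂μ + ∫ y, normTail n y ∂ν) := by
      rw [mul_add, ← integral_const_mul, ← integral_const_mul]
      refine hl Ψ _ _ ((integrable_normTail hμ1 n).const_mul K)
        ((integrable_normTail hν1 n).const_mul K) fun z => (hΨ z).trans ?_
      rw [← mul_add]
      refine le_trans ?_ (mul_le_mul_of_nonneg_left (mul_one_sub_cutoff_le n z) hK0)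
      rw [← mul_assoc]
      exact mul_le_mul_of_nonneg_right (hK z) (by linarith [cutoff_le_one n z])
    refine tendsto_iff_norm_sub_tendsto_zero.2 (squeeze_zero (fun _ => norm_nonneg _)
      (fun n => ?_) hT)
    rw [Real.norm_eq_abs, abs_le', neg_sub, ← map_sub, ← map_sub]
    constructor <;> refine key n _ fun z => ?_
    · have := neg_abs_le (Φ.1 z)
      have h1 := cutoff_le_one n z
      change Φ.1 z * cutoff n z - Φ.1 z ≤ _
      nlinarith
    · have := le_abs_self (Φ.1 z)
      have h1 := cutoff_le_one n z
      change Φ.1 z - Φ.1 z * cutoff n z ≤ _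
      nlinarith
  let w : linearGrowth d := ⟨fun z => 1 + ‖z.1‖ + ‖z.2‖, 1, fun z => by
    rw [one_mul, abs_of_nonneg (by positivity)]⟩
  have hwc : Continuous w.1 := by
    change Continuous fun z : Rd d × Rd d => 1 + ‖z.1‖ + ‖z.2‖
    fun_prop
  have hw0 (z) : 0 ≤ w.1 z := by
    change 0 ≤ 1 + ‖z.1‖ + ‖z.2‖
    positivity
  have hwi : Integrable w.1 π := by
    refine (lintegral_ofReal_ne_top_iff_integrable hwc.aestronglyMeasurable
      (ae_of_all _ hw0)).1 (ne_top_of_le_ne_top (b := ENNReal.ofReal (l w)) ENNReal.ofReal_ne_top ?_)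
    have h1 : ∫⁻ z, ENNReal.ofReal (w.1 z) ∂π =
        ∫⁻ z, liminf (fun n => ENNReal.ofReal ((w.1 * cutoff n : Rd d × Rd d → ℝ) z)) atTop ∂π := by
      refine lintegral_congr fun z => (Tendsto.liminf_eq ?_).symm
      refine (ENNReal.continuous_ofReal.tendsto _).comp ?_
      simpa using (tendsto_cutoff z).const_mul (w.1 z)
    rw [h1]
    refine (lintegral_liminf_le fun n => ((hcont w hwc n).measurable.ennreal_ofReal)).trans ?_
    refine liminf_le_of_le (by isBoundedDefault) fun b hb => ?_
    obtain ⟨n, hn⟩ := hb.exists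
    refine hn.trans ?_
    rw [← ofReal_integral_eq_lintegral_ofReal (hint w hwc n)
      (ae_of_all _ fun z => mul_nonneg (hw0 z) (cutoff_nonneg n z)), hrep w hwc n]
    refine ENNReal.ofReal_le_ofReal (sub_nonneg.1 ?_)
    rw [← map_sub]
    refine hpos _ fun z => sub_nonneg.2 ?_
    exact mul_le_of_le_one_right (hw0 z) (cutoff_le_one n z)
  have hΦi (Φ : linearGrowth d) (hΦ : Continuous Φ.1) : Integrable Φ.1 π := by
    obtain ⟨K, hK⟩ := Φ.2
    exact (hwi.const_mul K).mono' hΦ.aestronglyMeasurable (ae_of_all _ hK)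
  have hmain (Φ : linearGrowth d) (hΦ : Continuous Φ.1) : ∫ z, Φ.1 z ∂π = l Φ := by
    refine tendsto_nhds_unique ?_ (hlim Φ)
    simp_rw [← hrep Φ hΦ]
    refine tendsto_integral_of_dominated_convergence (fun z => |Φ.1 z|)
      (fun n => (hint Φ hΦ n).aestronglyMeasurable) (hΦi Φ hΦ).abs
      (fun n => ae_of_all _ fun z => ?_) (ae_of_all _ fun z => ?_)
    · rw [Pi.mul_apply, norm_mul, Real.norm_eq_abs, Real.norm_eq_abs]
      exact mul_le_of_le_one_right (abs_nonneg _) (abs_cutoff_le_one n z)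
    · simpa using (tendsto_cutoff z).const_mul (Φ.1 z)
  have hfin : IsFiniteMeasure π := by
    refine ((integrable_const_iff_isFiniteMeasure (one_ne_zero (α := ℝ))).1 ?_)
    exact hΦi ⟨fun _ => 1, mem_linearGrowth_of_bounded (C := 1) (by simp)⟩ continuous_const
  have hmarg (Φ : linearGrowth d) (hΦ : Continuous Φ.1) (f ψ : Rd d → ℝ) (hf : Integrable f μ)
      (hψ : Integrable ψ ν) (h : ∀ z, Φ.1 z = f z.1 + ψ z.2) :
      ∫ z, Φ.1 z ∂π = ∫ x, f x ∂μ + ∫ y, ψ y ∂ν := by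
    rw [hmain Φ hΦ]
    refine le_antisymm (hl Φ f ψ hf hψ fun z => (h z).le) ?_
    have := hl (-Φ) (-f) (-ψ) hf.neg hψ.neg fun z => by
      have := h z
      change -Φ.1 z ≤ -f z.1 + -ψ z.2
      linarith
    simp only [map_neg, integral_neg'] at this
    linarith
  have hfst : π.map Prod.fst = μ := by
    refine ext_of_forall_integral_eq_of_IsFiniteMeasure fun f => ?_
    rw [integral_map measurable_fst.aemeasurable f.continuous.aestronglyMeasurable]
    have := hmarg ⟨fun z => f z.1, mem_linearGrowth_of_bounded fun z => f.norm_coe_le_norm z.1⟩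
      (f.continuous.comp continuous_fst) f 0 (f.integrable μ) (integrable_zero _ _ _) (by simp)
    simpa using this
  have hsnd : π.map Prod.snd = ν := by
    refine ext_of_forall_integral_eq_of_IsFiniteMeasure fun f => ?_
    rw [integral_map measurable_snd.aemeasurable f.continuous.aestronglyMeasurable]
    have := hmarg ⟨fun z => f z.2, mem_linearGrowth_of_bounded fun z => f.norm_coe_le_norm z.2⟩
      (f.continuous.comp continuous_snd) 0 f (integrable_zero _ _ _) (f.integrable ν) (by simp)
    simpa using this
  refine ⟨π, ⟨⟨?_⟩, hfst, hsnd⟩, hmain⟩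
  rw [← preimage_univ (f := Prod.fst), ← Measure.map_apply measurable_fst .univ, hfst,
    measure_univ]

/-- Continuous lower bounds `h` for `(x, y) ↦ θ (x - y)` of linear growth that are concave and
equi-Lipschitz in the second variable. -/
structure IsConcaveMinorant {d : ℕ} (θ : Rd d → ℝ) (h : Rd d × Rd d → ℝ) : Prop where
  continuous : Continuous h
  mem_linearGrowth : h ∈ linearGrowth d
  lipschitz : ∃ G : ℝ, 0 ≤ G ∧ ∀ x y y', h (x, y) - h (x, y') ≤ G * ‖y - y'‖
  concave : ∀ x, ConcaveOn ℝ univ fun y => h (x, y)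
  le : ∀ x y, h (x, y) ≤ θ (x - y)

lemma IsConcaveMinorant.zero {d : ℕ} {θ : Rd d → ℝ} (hθ : ∀ v, 0 ≤ θ v) :
    IsConcaveMinorant θ 0 where
  continuous := continuous_zero
  mem_linearGrowth := zero_mem _
  lipschitz := ⟨0, le_rfl, by simp⟩
  concave _ := concaveOn_const 0 convex_univ
  le _ _ := hθ _

lemma IsConcaveMinorant.add {d : ℕ} {θ θ' : Rd d → ℝ} {h h' : Rd d × Rd d → ℝ}
    (H : IsConcaveMinorant θ h) (H' : IsConcaveMinorant θ' h') :
    IsConcaveMinorant (θ + θ') (h + h') where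
  continuous := H.continuous.add H'.continuous
  mem_linearGrowth := add_mem H.mem_linearGrowth H'.mem_linearGrowth
  lipschitz := by
    obtain ⟨G, hG, hG'⟩ := H.lipschitz
    obtain ⟨L, hL, hL'⟩ := H'.lipschitz
    refine ⟨G + L, add_nonneg hG hL, fun x y y' => ?_⟩
    simp only [Pi.add_apply]
    linarith [hG' x y y', hL' x y y']
  concave x := (H.concave x).add (H'.concave x)
  le x y := add_le_add (H.le x y) (H'.le x y)

lemma IsConcaveMinorant.smul {d : ℕ} {θ : Rd d → ℝ} {h : Rd d × Rd d → ℝ}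
    (H : IsConcaveMinorant θ h) {c : ℝ} (hc : 0 ≤ c) :
    IsConcaveMinorant (c • θ) (c • h) where
  continuous := H.continuous.const_smul c
  mem_linearGrowth := (linearGrowth d).smul_mem c H.mem_linearGrowth
  lipschitz := by
    obtain ⟨G, hG, hG'⟩ := H.lipschitz
    refine ⟨c * G, mul_nonneg hc hG, fun x y y' => ?_⟩
    simp only [Pi.smul_apply, smul_eq_mul]
    rw [← mul_sub, mul_assoc]
    exact mul_le_mul_of_nonneg_left (hG' x y y') hc
  concave x := (H.concave x).smul hc
  le x y := mul_le_mul_of_nonneg_left (H.le x y) hc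

/-- A continuous partition of unity subordinate to the almost maximal members of a finite family
of continuous functions. -/
lemma exists_partition_sup'_sub_le_sum {ι X : Type*} [TopologicalSpace X] {s : Finset ι}
    (hs : s.Nonempty) {L : ι → X → ℝ} (hL : ∀ i, Continuous (L i)) {ε : ℝ} (hε : 0 < ε) :
    ∃ φ : ι → X → ℝ, (∀ i, Continuous (φ i)) ∧ (∀ i u, 0 ≤ φ i u) ∧
      (∀ u, ∑ i ∈ s, φ i u = 1) ∧
      ∀ u, s.sup' hs (fun i => L i u) - ε ≤ ∑ i ∈ s, φ i u * L i u := by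
  let M : X → ℝ := fun u => s.sup' hs (fun i => L i u)
  have hM : Continuous M := Continuous.finset_sup'_apply hs fun i _ => hL i
  let p : ι → X → ℝ := fun i u => max 0 (L i u - M u + ε)
  have hp : ∀ i, Continuous (p i) := fun i => by
    have := hL i
    fun_prop
  have hp0 : ∀ i u, 0 ≤ p i u := fun i u => le_max_left _ _
  have hP : ∀ u, 0 < ∑ i ∈ s, p i u := fun u => by
    obtain ⟨i, hi, hiM⟩ := s.exists_mem_eq_sup' hs (fun i => L i u)
    refine Finset.sum_pos' (fun i _ => hp0 i u) ⟨i, hi, lt_max_of_lt_right ?_⟩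
    change 0 < L i u - s.sup' hs (fun i => L i u) + ε
    rw [hiM]
    linarith
  have hsum : ∀ u, ∑ i ∈ s, p i u / ∑ j ∈ s, p j u = 1 := fun u => by
    rw [← Finset.sum_div, div_self (hP u).ne']
  refine ⟨fun i u => p i u / ∑ j ∈ s, p j u, fun i => (hp i).div₀
    (continuous_finsetSum s fun j _ => hp j) fun u => (hP u).ne',
    fun i u => div_nonneg (hp0 i u) (hP u).le, hsum, fun u => ?_⟩
  have : M u - ε = ∑ i ∈ s, p i u / (∑ j ∈ s, p j u) * (M u - ε) := by
    rw [← Finset.sum_mul, hsum, one_mul]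
  change M u - ε ≤ _
  rw [this]
  refine Finset.sum_le_sum fun i _ => ?_
  rw [div_mul_eq_mul_div, div_mul_eq_mul_div]
  refine div_le_div_of_nonneg_right ?_ (hP u).le
  rcases le_total (L i u - M u + ε) 0 with h | h
  · simp [p, max_eq_left h]
  · exact mul_le_mul_of_nonneg_left (by linarith) (hp0 i u)

/-- A continuously parametrised convex combination of affine minorants of `θ`. -/
lemma isConcaveMinorant_sum {d : ℕ} {θ : Rd d → ℝ} {ι : Type*} {s : Finset ι}
    {l : ι → Rd d →L[ℝ] ℝ} {c : ι → ℝ} (hlc : ∀ i v, l i v + c i ≤ θ v)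
    {φ : ι → Rd d → ℝ} (hφ : ∀ i, Continuous (φ i)) (hφ0 : ∀ i u, 0 ≤ φ i u)
    (hφ1 : ∀ u, ∑ i ∈ s, φ i u = 1) :
    IsConcaveMinorant θ fun z => ∑ i ∈ s, φ i z.1 * (l i (z.1 - z.2) + c i) where
  continuous := by
    refine continuous_finsetSum s fun i _ => ?_
    have := hφ i
    fun_prop
  mem_linearGrowth := by
    have hφle : ∀ i ∈ s, ∀ u, φ i u ≤ 1 := fun i hi u => by
      rw [← hφ1 u]
      exact Finset.single_le_sum (f := fun i => φ i u) (fun j _ => hφ0 j u) hi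
    refine ⟨∑ i ∈ s, (‖l i‖ + |c i|), fun z => (Finset.abs_sum_le_sum_abs _ _).trans ?_⟩
    rw [Finset.sum_mul]
    refine Finset.sum_le_sum fun i hi => ?_
    rw [abs_mul, abs_of_nonneg (hφ0 i _)]
    refine (mul_le_of_le_one_left (abs_nonneg _) (hφle i hi _)).trans ?_
    have h1 : |l i (z.1 - z.2)| ≤ ‖l i‖ * (‖z.1‖ + ‖z.2‖) :=
      ((l i).le_opNorm _).trans (by gcongr; exact norm_sub_le _ _)
    have h2 := abs_add_le (l i (z.1 - z.2)) (c i)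
    have h3 : 0 ≤ ‖l i‖ := norm_nonneg _
    have h4 : 0 ≤ |c i| * (‖z.1‖ + ‖z.2‖) := by positivity
    linarith
  lipschitz := by
    refine ⟨∑ i ∈ s, ‖l i‖, Finset.sum_nonneg fun _ _ => norm_nonneg _, fun x y y' => ?_⟩
    have hφle : ∀ i ∈ s, φ i x ≤ 1 := fun i hi => by
      rw [← hφ1 x]
      exact Finset.single_le_sum (f := fun i => φ i x) (fun j _ => hφ0 j x) hi
    rw [← Finset.sum_sub_distrib, Finset.sum_mul]
    refine Finset.sum_le_sum fun i hi => ?_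
    have h1 : φ i x * (l i (x - y) + c i) - φ i x * (l i (x - y') + c i) =
        φ i x * l i (y' - y) := by
      simp only [map_sub]
      ring
    rw [h1, norm_sub_rev]
    calc φ i x * l i (y' - y) ≤ φ i x * (‖l i‖ * ‖y' - y‖) :=
          mul_le_mul_of_nonneg_left ((le_abs_self _).trans ((l i).le_opNorm _)) (hφ0 i x)
      _ ≤ _ := mul_le_of_le_one_left (by positivity) (hφle i hi)
  concave x := by
    refine ⟨convex_univ, fun y _ y' _ a b _ _ hab => le_of_eq ?_⟩
    simp only [smul_eq_mul, Finset.mul_sum]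
    rw [← Finset.sum_add_distrib]
    refine Finset.sum_congr rfl fun i _ => ?_
    simp only [map_sub, map_add, map_smul, smul_eq_mul]
    linear_combination (φ i x * (l i x + c i)) * hab
  le x y := by
    calc ∑ i ∈ s, φ i x * (l i (x - y) + c i) ≤ ∑ i ∈ s, φ i x * θ (x - y) :=
          Finset.sum_le_sum fun i _ => mul_le_mul_of_nonneg_left (hlc i _) (hφ0 i x)
      _ = θ (x - y) := by rw [← Finset.sum_mul, hφ1, one_mul]

lemma IsCoupling.integral_sup'_le {d : ℕ} {θ : Rd d → ℝ} {μ ν : Measure (Rd d)}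
    [IsProbabilityMeasure μ] [IsProbabilityMeasure ν]
    (hμ1 : HasMomentP 1 μ) (hν1 : HasMomentP 1 ν) {π : Measure (Rd d × Rd d)}
    (hπ : IsCoupling π μ ν) {D : ℝ}
    (hD : ∀ h, IsConcaveMinorant θ h → ∫ z, h z ∂π ≤ D)
    {ι : Type*} {s : Finset ι} (hs : s.Nonempty)
    {l : ι → Rd d →L[ℝ] ℝ} {c : ι → ℝ} (hlc : ∀ i v, l i v + c i ≤ θ v) :
    Integrable (fun x => s.sup' hs fun i => l i (x - ∫ y, y ∂(disint π x)) + c i) μ ∧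
      ∫ x, (s.sup' hs fun i => l i (x - ∫ y, y ∂(disint π x)) + c i) ∂μ ≤ D := by
  have := hπ.1
  have := isMarkovKernel_disint π
  have hidμ : Integrable (fun x : Rd d => x) μ :=
    (integrable_norm_iff (by fun_prop)).1 hμ1.integrable_norm
  have hidν : Integrable (fun y : Rd d => y) ν :=
    (integrable_norm_iff (by fun_prop)).1 hν1.integrable_norm
  have hsnd := hπ.integrable_snd hidν
  let m : Rd d → Rd d := fun x => ∫ y, y ∂(disint π x)
  have hm : Integrable m μ := hπ.integrable_integral_section hsnd
  let M : Rd d → ℝ := fun u => s.sup' hs fun i => l i u + c i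
  have hL : ∀ i, Continuous fun u => l i u + c i := fun i => by fun_prop
  have hMc : Continuous M := Continuous.finset_sup'_apply hs fun i _ => hL i
  let C : ℝ := ∑ i ∈ s, ‖l i‖
  have hC0 : 0 ≤ C := Finset.sum_nonneg fun _ _ => norm_nonneg _
  have hLC : ∀ i ∈ s, ∀ u u', l i u + c i ≤ l i u' + c i + C * ‖u - u'‖ := fun i hi u u' => by
    have h1 : l i u - l i u' ≤ ‖l i‖ * ‖u - u'‖ := by
      rw [← map_sub]
      exact (le_abs_self _).trans ((l i).le_opNorm _)
    have h2 : ‖l i‖ ≤ C := Finset.single_le_sum (f := fun i => ‖l i‖)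
      (fun _ _ => norm_nonneg _) hi
    have h3 := mul_le_mul_of_nonneg_right h2 (norm_nonneg (u - u'))
    linarith
  have hMC : ∀ u u', M u ≤ M u' + C * ‖u - u'‖ := fun u u' =>
    Finset.sup'_le hs _ fun i hi => (hLC i hi u u').trans
      (add_le_add_left (Finset.le_sup' (fun i => l i u' + c i) hi) _)
  have hMi : Integrable (fun x => M (x - m x)) μ := by
    refine Integrable.mono' (g := fun x => |M 0| + C * ‖x - m x‖)
      ((integrable_const _).add ((hidμ.sub hm).norm.const_mul C))
      (hMc.comp_aestronglyMeasurable (hidμ.sub hm).aestronglyMeasurable)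
      (ae_of_all _ fun x => ?_)
    have h1 := hMC (x - m x) 0
    have h2 := hMC 0 (x - m x)
    rw [sub_zero] at h1
    rw [zero_sub, norm_neg] at h2
    rw [Real.norm_eq_abs, abs_le]
    constructor
    · linarith [neg_abs_le (M 0)]
    · linarith [le_abs_self (M 0)]
  refine ⟨hMi, ?_⟩
  have key : ∀ δ : ℝ, 0 < δ → ∫ x, M (x - m x) ∂μ ≤ D + (1 + 2 * C) * δ := fun δ hδ => by
    obtain ⟨g, -, hgδ, hgc, hgi⟩ := hm.exists_hasCompactSupport_integral_sub_le hδ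
    obtain ⟨φ, hφ, hφ0, hφ1, hφM⟩ := exists_partition_sup'_sub_le_sum hs hL hδ
    let h : Rd d × Rd d → ℝ :=
      fun z => ∑ i ∈ s, φ i (z.1 - g z.1) * (l i (z.1 - z.2) + c i)
    have hh : IsConcaveMinorant θ h :=
      isConcaveMinorant_sum (φ := fun i x => φ i (x - g x)) hlc
        (fun i => (hφ i).comp (continuous_id.sub hgc)) (fun _ _ => hφ0 _ _) fun _ => hφ1 _
    have hhi : Integrable h π := by
      obtain ⟨K, hK⟩ := hh.mem_linearGrowth
      refine Integrable.mono' (g := fun z => K * (1 + ‖z.1‖ + ‖z.2‖)) ?_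
        hh.continuous.aestronglyMeasurable (ae_of_all _ hK)
      exact (((integrable_const 1).add (hπ.integrable_fst hμ1.integrable_norm)).add
        (hπ.integrable_snd hν1.integrable_norm)).const_mul K
    have hle := hD h hh
    rw [← hπ.integral_integral_section hhi] at hle
    have hpt : ∀ᵐ x ∂μ, M (x - m x) - δ - 2 * C * ‖m x - g x‖ ≤
        ∫ y, h (x, y) ∂(disint π x) := by
      filter_upwards [hπ.integrable_section hsnd] with x hx
      have hsub : Integrable (fun y => x - y) (disint π x) := (integrable_const x).sub hx
      have hint : ∀ i, Integrable (fun y => φ i (x - g x) * (l i (x - y) + c i)) (disint π x) :=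
        fun i => (((l i).integrable_comp hsub).add (integrable_const (c i))).const_mul _
      have h1 : ∫ y, h (x, y) ∂(disint π x) =
          ∑ i ∈ s, φ i (x - g x) * (l i (x - m x) + c i) := by
        change ∫ y, ∑ i ∈ s, φ i (x - g x) * (l i (x - y) + c i) ∂(disint π x) = _
        rw [integral_finsetSum s fun i _ => hint i]
        refine Finset.sum_congr rfl fun i _ => ?_
        rw [integral_const_mul, integral_add ((l i).integrable_comp hsub) (integrable_const (c i)),
          (l i).integral_comp_comm hsub, integral_sub (integrable_const x) hx]
        simp [m]
      have h2 : ∑ i ∈ s, φ i (x - g x) * (l i (x - g x) + c i) ≤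
          ∑ i ∈ s, φ i (x - g x) * (l i (x - m x) + c i) + C * ‖m x - g x‖ := by
        have h3 : C * ‖m x - g x‖ = ∑ i ∈ s, φ i (x - g x) * (C * ‖m x - g x‖) := by
          rw [← Finset.sum_mul, hφ1, one_mul]
        rw [h3, ← Finset.sum_add_distrib]
        refine Finset.sum_le_sum fun i hi => ?_
        rw [← mul_add]
        refine mul_le_mul_of_nonneg_left ?_ (hφ0 _ _)
        simpa using hLC i hi (x - g x) (x - m x)
      have h4 := hφM (x - g x)
      have h5 : M (x - m x) ≤ M (x - g x) + C * ‖m x - g x‖ := by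
        have := hMC (x - m x) (x - g x)
        rwa [sub_sub_sub_cancel_left, norm_sub_rev] at this
      change M (x - g x) - δ ≤ _ at h4
      rw [h1]
      linarith
    have hmg := (hm.sub hgi).norm
    have hi1 : Integrable (fun x => M (x - m x) - δ) μ := hMi.sub (integrable_const δ)
    have hi2 : Integrable (fun x => 2 * C * ‖m x - g x‖) μ := hmg.const_mul (2 * C)
    have h6 := integral_mono_ae (hi1.sub hi2) (hπ.integrable_integral_section hhi) hpt
    simp only [Pi.sub_apply] at h6
    rw [integral_sub hi1 hi2, integral_sub hMi (integrable_const δ), integral_const_mul] at h6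
    simp only [integral_const, probReal_univ, one_smul] at h6
    nlinarith [mul_le_mul_of_nonneg_left hgδ hC0]
  refine le_of_forall_pos_le_add fun ε hε => ?_
  have h1 : 0 < 1 + 2 * C := by positivity
  have h2 := key (ε / (1 + 2 * C)) (by positivity)
  rwa [mul_div_cancel₀ _ h1.ne'] at h2

lemma IsCoupling.lintegral_le {d : ℕ} {θ : Rd d → ℝ}
    (hθ_conv : ConvexOn ℝ univ θ) (hθ_nonneg : ∀ v, 0 ≤ θ v) {μ ν : Measure (Rd d)}
    [IsProbabilityMeasure μ] [IsProbabilityMeasure ν]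
    (hμ1 : HasMomentP 1 μ) (hν1 : HasMomentP 1 ν) {π : Measure (Rd d × Rd d)}
    (hπ : IsCoupling π μ ν) {D : ℝ}
    (hD : ∀ h, IsConcaveMinorant θ h → ∫ z, h z ∂π ≤ D) :
    ∫⁻ x, ENNReal.ofReal (θ (x - ∫ y, y ∂(disint π x))) ∂μ ≤ ENNReal.ofReal D := by
  obtain ⟨l₀, c₀, hle₀, hsup⟩ := hθ_conv.real_univ_sSup_of_nat_affine_eq
    (continuous_of_convexOn hθ_conv).lowerSemicontinuous
  let l : ℕ → Rd d →L[ℝ] ℝ := fun n => Nat.casesOn n 0 l₀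
  let c : ℕ → ℝ := fun n => Nat.casesOn n 0 c₀
  have hlc : ∀ i v, l i v + c i ≤ θ v := by
    rintro (_ | i) v
    · simpa [l, c] using hθ_nonneg v
    · exact hle₀ i v
  let M : ℕ → Rd d → ℝ := fun n u =>
    (Finset.range (n + 1)).sup' Finset.nonempty_range_add_one fun i => l i u + c i
  have hMθ : ∀ n u, M n u ≤ θ u := fun n u => Finset.sup'_le _ _ fun i _ => hlc i u
  have hM0 : ∀ n u, 0 ≤ M n u := fun n u => by
    have := Finset.le_sup' (fun i => l i u + c i) (Finset.mem_range.2 n.succ_pos)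
    simpa [l, c] using this
  have hlim : ∀ u, Tendsto (fun n => M n u) atTop (𝓝 (θ u)) := fun u => by
    refine tendsto_order.2 ⟨fun a ha => ?_, fun a ha => Eventually.of_forall fun n =>
      (hMθ n u).trans_lt ha⟩
    have hu : ⨆ i, (l₀ i u + c₀ i) = θ u := by
      have := congrFun hsup u
      rwa [iSup_apply] at this
    rw [← hu] at ha
    obtain ⟨i, hi⟩ := exists_lt_of_lt_ciSup ha
    filter_upwards [eventually_ge_atTop (i + 1)] with n hn
    exact hi.trans_le (Finset.le_sup' (fun i => l i u + c i)
      (Finset.mem_range.2 (show i + 1 < n + 1 by lia)))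
  have hMn := fun n => hπ.integral_sup'_le hμ1 hν1 hD
    (s := Finset.range (n + 1)) Finset.nonempty_range_add_one hlc
  have h1 : ∫⁻ x, ENNReal.ofReal (θ (x - ∫ y, y ∂(disint π x))) ∂μ =
      ∫⁻ x, liminf (fun n => ENNReal.ofReal (M n (x - ∫ y, y ∂(disint π x)))) atTop ∂μ :=
    lintegral_congr fun x => (Tendsto.liminf_eq
      ((ENNReal.continuous_ofReal.tendsto _).comp (hlim _))).symm
  rw [h1]
  refine (lintegral_liminf_le' fun n => (hMn n).1.aemeasurable.ennreal_ofReal).trans ?_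
  refine liminf_le_of_le (by isBoundedDefault) fun b hb => ?_
  obtain ⟨n, hn⟩ := hb.exists
  refine hn.trans ?_
  rw [← ofReal_integral_eq_lintegral_ofReal (hMn n).1 (ae_of_all _ fun x => hM0 n _)]
  exact ENNReal.ofReal_le_ofReal (hMn n).2

lemma integral_add_integral_le_of_le_isConcaveMinorant {d : ℕ} {θ : Rd d → ℝ}
    {μ ν : Measure (Rd d)} [IsProbabilityMeasure ν] (hν1 : HasMomentP 1 ν) {D : ℝ}
    (hD : ∀ ψ : Rd d → ℝ, Cbp 1 ψ → ConvexOn ℝ univ ψ →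
      eInt μ (fun x => ⨅ z : Rd d, ((ψ z + θ (x - z) : ℝ) : EReal)) -
        ((∫ y, ψ y ∂ν : ℝ) : EReal) ≤ (D : EReal))
    {h : Rd d × Rd d → ℝ} (hh : IsConcaveMinorant θ h) {f ψ : Rd d → ℝ}
    (hf : Integrable f μ) (hψ : Integrable ψ ν) (hle : ∀ x y, f x + ψ y ≤ h (x, y)) :
    ∫ x, f x ∂μ + ∫ y, ψ y ∂ν ≤ D := by
  obtain ⟨G, hG, hGh⟩ := hh.lipschitz
  let g : Rd d → ℝ := fun y => ⨆ x, (f x - h (x, y))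
  have hbdd : ∀ y, BddAbove (range fun x => f x - h (x, y)) := fun y =>
    ⟨-ψ y, forall_mem_range.2 fun x => by linarith [hle x y]⟩
  have hfg : ∀ x y, f x - h (x, y) ≤ g y := fun x y => le_ciSup (hbdd y) x
  have hgψ : ∀ y, g y ≤ -ψ y := fun y => ciSup_le fun x => by linarith [hle x y]
  have hgG : ∀ y y', g y ≤ g y' + G * ‖y - y'‖ := fun y y' => ciSup_le fun x => by
    have := hGh x y' y
    rw [norm_sub_rev] at this
    linarith [hfg x y']
  have hgconv : ConvexOn ℝ univ g := by
    refine ⟨convex_univ, fun y _ y' _ a b ha hb hab => ciSup_le fun x => ?_⟩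
    have h1 := (hh.concave x).2 (mem_univ y) (mem_univ y') ha hb hab
    have h2 := mul_le_mul_of_nonneg_left (hfg x y) ha
    have h3 := mul_le_mul_of_nonneg_left (hfg x y') hb
    have h4 : f x = a * f x + b * f x := by rw [← add_mul, hab, one_mul]
    simp only [smul_eq_mul] at h1 ⊢
    linarith
  have hgcont : Continuous g := continuous_of_convexOn hgconv
  have hg0 : ∀ y, |g y| ≤ |g 0| + G * ‖y‖ := fun y => by
    have h1 := hgG y 0
    have h2 := hgG 0 y
    rw [sub_zero] at h1
    rw [zero_sub, norm_neg] at h2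
    rw [abs_le]
    constructor
    · linarith [neg_abs_le (g 0)]
    · linarith [le_abs_self (g 0)]
  have hgint : Integrable g ν :=
    ((integrable_const |g 0|).add (hν1.integrable_norm.const_mul G)).mono'
      hgcont.aestronglyMeasurable (ae_of_all _ hg0)
  have htrunc : ∀ n : ℕ, ∫ x, f x ∂μ - ∫ y, max (g y) (-n) ∂ν ≤ D := fun n => by
    have hC : Cbp 1 fun y => max (g y) (-n) := by
      refine ⟨by fun_prop, ⟨-n, fun y => le_max_right _ _⟩, |g 0| + G + 1, by positivity, 0,
        fun y => ?_⟩
      rw [sub_zero, Real.rpow_one]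
      refine max_le ?_ ?_
      · have := hg0 y
        nlinarith [le_abs_self (g y), norm_nonneg y, abs_nonneg (g 0),
          mul_nonneg (abs_nonneg (g 0)) (norm_nonneg y)]
      · exact (neg_nonpos.2 n.cast_nonneg).trans (by positivity)
    have h1 := hD _ hC (hgconv.sup (convexOn_const _ convex_univ))
    have h2 : ((∫ x, f x ∂μ : ℝ) : EReal) ≤
        eInt μ (fun x => ⨅ z : Rd d, ((max (g z) (-n) + θ (x - z) : ℝ) : EReal)) := by
      rw [← eInt_coe hf]
      refine eInt_mono_ae (ae_of_all _ fun x => le_iInf fun z => EReal.coe_le_coe_iff.2 ?_)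
      linarith [hfg x z, hh.le x z, le_max_left (g z) (-n)]
    have h3 := (EReal.sub_le_sub h2 le_rfl).trans h1
    rwa [← EReal.coe_sub, EReal.coe_le_coe_iff] at h3
  have hlim : Tendsto (fun n : ℕ => ∫ y, max (g y) (-n) ∂ν) atTop (𝓝 (∫ y, g y ∂ν)) := by
    refine tendsto_integral_of_dominated_convergence (fun y => |g y|)
      (fun n => (hgcont.max continuous_const).aestronglyMeasurable) hgint.abs
      (fun n => ae_of_all _ fun y => ?_) (ae_of_all _ fun y => ?_)
    · rw [Real.norm_eq_abs, abs_le]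
      exact ⟨(neg_abs_le _).trans (le_max_left _ _), max_le (le_abs_self _)
        ((neg_nonpos.2 n.cast_nonneg).trans (abs_nonneg _))⟩
    · refine tendsto_const_nhds.congr' ?_
      obtain ⟨N, hN⟩ := exists_nat_ge (-g y)
      filter_upwards [eventually_ge_atTop N] with n hn
      have : (N : ℝ) ≤ n := by exact_mod_cast hn
      exact (max_eq_left (by linarith)).symm
  have h1 : ∫ x, f x ∂μ - ∫ y, g y ∂ν ≤ D :=
    le_of_tendsto (tendsto_const_nhds.sub hlim) (Eventually.of_forall htrunc)
  have h2 : ∫ y, g y ∂ν ≤ -∫ y, ψ y ∂ν := by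
    rw [← integral_neg]
    exact integral_mono hgint hψ.neg hgψ
  linarith

/-- The pairs `(Φ, r)` for which `Φ ≤ f ⊕ ψ + h` with `h` a concave minorant of `t • θ` and
`∫ f dμ + ∫ ψ dν + t * D ≤ r`. -/
def superhedgingCone {d : ℕ} (θ : Rd d → ℝ) (μ ν : Measure (Rd d)) (D : ℝ) :
    PointedCone ℝ (linearGrowth d × ℝ) where
  carrier := {p | ∃ (t : ℝ) (h : Rd d × Rd d → ℝ) (f ψ : Rd d → ℝ), 0 ≤ t ∧
    IsConcaveMinorant (t • θ) h ∧ Integrable f μ ∧ Integrable ψ ν ∧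
    (∀ z, p.1.1 z ≤ f z.1 + ψ z.2 + h z) ∧ ∫ x, f x ∂μ + ∫ y, ψ y ∂ν + t * D ≤ p.2}
  zero_mem' := ⟨0, 0, 0, 0, le_rfl, .zero (by simp), integrable_zero .., integrable_zero ..,
    by simp, by simp⟩
  add_mem' := by
    rintro p q ⟨t, h, f, ψ, ht, hh, hf, hψ, hle, hr⟩ ⟨t', h', f', ψ', ht', hh', hf', hψ', hle', hr'⟩
    refine ⟨t + t', h + h', f + f', ψ + ψ', add_nonneg ht ht', ?_, hf.add hf', hψ.add hψ',
      fun z => ?_, ?_⟩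
    · rw [add_smul]
      exact hh.add hh'
    · have h1 := hle z
      have h2 := hle' z
      simp only [Prod.fst_add, Submodule.coe_add, Pi.add_apply]
      linarith
    · rw [integral_add' hf hf', integral_add' hψ hψ', Prod.snd_add]
      linarith
  smul_mem' := by
    rintro ⟨c, hc⟩ p ⟨t, h, f, ψ, ht, hh, hf, hψ, hle, hr⟩
    refine ⟨c * t, c • h, c • f, c • ψ, mul_nonneg hc ht, ?_, hf.smul c, hψ.smul c,
      fun z => ?_, ?_⟩
    · rw [mul_smul]
      exact hh.smul hc
    · have h1 := mul_le_mul_of_nonneg_left (hle z) hc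
      change c * p.1.1 z ≤ c * f z.1 + c * ψ z.2 + c * h z
      linarith
    · have h1 := mul_le_mul_of_nonneg_left hr hc
      change ∫ x, c * f x ∂μ + ∫ y, c * ψ y ∂ν + c * t * D ≤ c * p.2
      rw [integral_const_mul, integral_const_mul]
      linarith

lemma nonneg_of_mem_superhedgingCone {d : ℕ} {θ : Rd d → ℝ}
    {μ ν : Measure (Rd d)} [IsProbabilityMeasure μ] [IsProbabilityMeasure ν]
    (hν1 : HasMomentP 1 ν) {D : ℝ}
    (hD : ∀ ψ : Rd d → ℝ, Cbp 1 ψ → ConvexOn ℝ univ ψ →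
      eInt μ (fun x => ⨅ z : Rd d, ((ψ z + θ (x - z) : ℝ) : EReal)) -
        ((∫ y, ψ y ∂ν : ℝ) : EReal) ≤ (D : EReal))
    {r : ℝ} (hr : ((0 : linearGrowth d), r) ∈ superhedgingCone θ μ ν D) : 0 ≤ r := by
  obtain ⟨t, h, f, ψ, ht, hh, hf, hψ, hle, hr⟩ := hr
  have hle' : ∀ z, 0 ≤ f z.1 + ψ z.2 + h z := hle
  refine le_trans ?_ hr
  rcases ht.eq_or_lt with rfl | ht
  · have h1 : ∀ x y, 0 ≤ f x + ψ y := fun x y => by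
      have h2 := hle' (x, y)
      have h3 := hh.le x y
      simp only [zero_smul, Pi.zero_apply] at h3
      linarith
    have h2 : ∀ x, 0 ≤ f x + ∫ y, ψ y ∂ν := fun x => by
      have h3 : 0 ≤ ∫ y, (f x + ψ y) ∂ν := integral_nonneg (h1 x)
      rw [integral_add (integrable_const _) hψ] at h3
      simpa using h3
    have h3 : 0 ≤ ∫ x, (f x + ∫ y, ψ y ∂ν) ∂μ := integral_nonneg h2
    rw [integral_add hf (integrable_const _)] at h3
    simpa using h3
  · have ht' : 0 ≤ t⁻¹ := inv_nonneg.2 ht.le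
    have hh' := hh.smul ht'
    rw [smul_smul, inv_mul_cancel₀ ht.ne', one_smul] at hh'
    have h1 := integral_add_integral_le_of_le_isConcaveMinorant hν1 hD hh'
      (hf.const_mul (-t⁻¹)) (hψ.const_mul (-t⁻¹)) fun x y => by
        have h2 := mul_le_mul_of_nonneg_left (hle' (x, y)) ht'
        change -t⁻¹ * f x + -t⁻¹ * ψ y ≤ t⁻¹ * h (x, y)
        linarith
    rw [integral_const_mul, integral_const_mul] at h1
    have h2 := mul_le_mul_of_nonneg_left h1 ht.le
    have h3 : t * (-t⁻¹ * ∫ x, f x ∂μ + -t⁻¹ * ∫ y, ψ y ∂ν) =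
        -(∫ x, f x ∂μ + ∫ y, ψ y ∂ν) := by
      field_simp
      ring
    linarith

lemma exists_isCoupling_lintegral_le {d : ℕ} {θ : Rd d → ℝ}
    (hθ_conv : ConvexOn ℝ univ θ) (hθ : ∀ v, 0 ≤ θ v) {μ ν : Measure (Rd d)}
    [IsProbabilityMeasure μ] [IsProbabilityMeasure ν]
    (hμ1 : HasMomentP 1 μ) (hν1 : HasMomentP 1 ν) {D : ℝ}
    (hD : ∀ ψ : Rd d → ℝ, Cbp 1 ψ → ConvexOn ℝ univ ψ →
      eInt μ (fun x => ⨅ z : Rd d, ((ψ z + θ (x - z) : ℝ) : EReal)) -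
        ((∫ y, ψ y ∂ν : ℝ) : EReal) ≤ (D : EReal)) :
    ∃ π, IsCoupling π μ ν ∧
      ∫⁻ x, ENNReal.ofReal (θ (x - ∫ y, y ∂(disint π x))) ∂μ ≤ ENNReal.ofReal D := by
  have h0 : IsConcaveMinorant ((0 : ℝ) • θ) 0 := .zero (by simp)
  obtain ⟨l, hl⟩ := exists_linearMap_le_of_pointedCone (superhedgingCone θ μ ν D)
    (fun r hr => nonneg_of_mem_superhedgingCone hν1 hD hr) (fun Φ => by
      obtain ⟨K, hK⟩ := Φ.2
      refine ⟨_, 0, 0, fun x => K * (1 + ‖x‖), fun y => K * ‖y‖, le_rfl, h0,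
        ((integrable_const 1).add hμ1.integrable_norm).const_mul K,
        hν1.integrable_norm.const_mul K, fun z => ?_, le_rfl⟩
      have h1 := (le_abs_self _).trans (hK z)
      simp only [Pi.zero_apply, add_zero]
      linarith)
  obtain ⟨π, hπ, hπl⟩ := exists_isCoupling_integral_eq hμ1 hν1 l fun Φ f ψ hf hψ hle =>
    hl _ _ ⟨0, 0, f, ψ, le_rfl, h0, hf, hψ, fun z => by simpa using hle z, by simp⟩
  refine ⟨π, hπ, hπ.lintegral_le hθ_conv hθ hμ1 hν1 fun h hh => ?_⟩
  rw [hπl ⟨h, hh.mem_linearGrowth⟩ hh.continuous]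
  exact hl _ _ ⟨1, h, 0, 0, zero_le_one, by rwa [one_smul], integrable_zero ..,
    integrable_zero .., by simp, by simp⟩

/-- **Barycentric weak transport duality** (Gozlan–Juillet): for convex `θ : ℝ^d → [0,∞)`
and `μ, ν ∈ P₁(ℝ^d)`,
`inf_π ∫ θ(x - mean π_x) dμ = sup { μ(ψ^C) - ν(ψ) : ψ ∈ C_{b,1} convex }`,
where `ψ^C(x) = inf_z ψ(z) + θ(x - z)`. -/
theorem barycentric_duality {d : ℕ} (θ : Rd d → ℝ)
    (hθ_conv : ConvexOn ℝ Set.univ θ) (hθ_nonneg : ∀ v, 0 ≤ θ v)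
    (μ ν : Measure (Rd d))
    (hμ : IsProbabilityMeasure μ) (hν : IsProbabilityMeasure ν)
    (hμ1 : HasMomentP 1 μ) (hν1 : HasMomentP 1 ν) :
    ((⨅ π : {π : Measure (Rd d × Rd d) // IsCoupling π μ ν},
        ∫⁻ x, ENNReal.ofReal (θ (x - ∫ y, y ∂(disint π.1 x))) ∂μ : ℝ≥0∞) : EReal)
      = ⨆ ψ : {ψ : Rd d → ℝ // Cbp 1 ψ ∧ ConvexOn ℝ Set.univ ψ},
          eInt μ (fun x => ⨅ z : Rd d, ((ψ.1 z + θ (x - z) : ℝ) : EReal))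
            - ((∫ y, ψ.1 y ∂ν : ℝ) : EReal) := by
  refine le_antisymm ?_ (iSup_le fun ψ => ?_)
  · let V : EReal := ⨆ ψ : {ψ : Rd d → ℝ // Cbp 1 ψ ∧ ConvexOn ℝ Set.univ ψ},
      eInt μ (fun x => ⨅ z : Rd d, ((ψ.1 z + θ (x - z) : ℝ) : EReal))
        - ((∫ y, ψ.1 y ∂ν : ℝ) : EReal)
    change _ ≤ V
    have hV : ∀ ψ : Rd d → ℝ, Cbp 1 ψ → ConvexOn ℝ univ ψ →
        eInt μ (fun x => ⨅ z : Rd d, ((ψ z + θ (x - z) : ℝ) : EReal)) -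
          ((∫ y, ψ y ∂ν : ℝ) : EReal) ≤ V := fun ψ h1 h2 =>
      le_iSup (fun ψ : {ψ : Rd d → ℝ // Cbp 1 ψ ∧ ConvexOn ℝ Set.univ ψ} =>
        eInt μ (fun x => ⨅ z : Rd d, ((ψ.1 z + θ (x - z) : ℝ) : EReal))
          - ((∫ y, ψ.1 y ∂ν : ℝ) : EReal)) ⟨ψ, h1, h2⟩
    have hV0 : 0 ≤ V := by
      refine le_trans ?_ (hV (fun _ => 0) ⟨continuous_const, ⟨0, fun _ => le_rfl⟩, 1, one_pos, 0,
        fun y => by positivity⟩ (convexOn_const 0 convex_univ))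
      have h1 : ∀ x : Rd d, (((0 : Rd d → ℝ) x : ℝ) : EReal) ≤
          ⨅ z : Rd d, ((0 + θ (x - z) : ℝ) : EReal) := fun x =>
        le_iInf fun z => EReal.coe_le_coe_iff.2 (by simpa using hθ_nonneg (x - z))
      have h2 := eInt_mono_ae (μ := μ) (ae_of_all _ h1)
      rw [eInt_coe (integrable_zero ..)] at h2
      simpa using h2
    generalize V = W at hV hV0
    induction W with
    | bot => simp at hV0
    | top => exact le_top
    | coe D =>
      obtain ⟨π, hπ, hle⟩ := exists_isCoupling_lintegral_le hθ_conv hθ_nonneg hμ1 hν1 hV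
      refine (EReal.coe_ennreal_le_coe_ennreal_iff.2 ((iInf_le _ ⟨π, hπ⟩).trans hle)).trans ?_
      rw [EReal.coe_ennreal_ofReal, max_eq_left (EReal.coe_nonneg.1 hV0)]
  · refine ((le_max_right _ _).trans_eq EReal.coe_toENNReal_eq_max.symm).trans
      (EReal.coe_ennreal_le_coe_ennreal_iff.2 (le_iInf fun π => ?_))
    have h1 := EReal.toENNReal_le_toENNReal
      (dual_le_of_isCoupling (continuous_of_convexOn hθ_conv) hθ_nonneg hν1 π.2 ψ.2.1 ψ.2.2)
    rwa [EReal.toENNReal_coe] at h1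
end

section
/- (Increasing convex Kantorovich–Rubinstein formula) Let q ∈ [1,∞], let ‖·‖_q denote the ℓ^q norm on ℝ^d, and for v ∈ ℝ^d let (v)₊ denote its coordinatewise positive part. Then for all μ, ν ∈ P₁(ℝ^d), inf_{π ∈ Π(μ,ν)} ∫_{ℝ^d} ‖(x − mean(π_x))₊‖_q dμ(x) = sup { ∫ψ dμ − ∫ψ dν : ψ : ℝ^d → ℝ convex, coordinatewise increasing, and 1-Lipschitz with respect to ‖·‖_q }. -/
open MeasureTheory Set Filter Topology
open scoped ENNReal

noncomputable section

open scoped Classical in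
/-- The `ℓ^q` norm on `ℝ^d`, for `q ∈ [1,∞]`. -/
def lqNorm (q : ℝ≥0∞) {d : ℕ} (v : Fin d → ℝ) : ℝ :=
  if q = ⊤ then ⨆ i, |v i| else (∑ i, |v i| ^ q.toReal) ^ (1 / q.toReal)

end

section LqNorm

variable {d : ℕ} {q : ℝ≥0∞}

lemma lqNorm_eq_norm (hq : 1 ≤ q) (v : Fin d → ℝ) :
    lqNorm q v = ‖(WithLp.toLp q v : PiLp q (fun _ : Fin d => ℝ))‖ := by
  unfold lqNorm
  split_ifs with h
  · subst h
    simp [PiLp.norm_eq_ciSup]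
  · have : 0 < q.toReal := ENNReal.toReal_pos (by positivity) h
    simp [PiLp.norm_eq_sum this]

lemma lqNorm_nonneg (hq : 1 ≤ q) (v : Fin d → ℝ) : 0 ≤ lqNorm q v := by
  rw [lqNorm_eq_norm hq]
  have : Fact (1 ≤ q) := ⟨hq⟩
  exact norm_nonneg _

lemma lqNorm_add_le (hq : 1 ≤ q) (v w : Fin d → ℝ) :
    lqNorm q (v + w) ≤ lqNorm q v + lqNorm q w := by
  have : Fact (1 ≤ q) := ⟨hq⟩
  simp only [lqNorm_eq_norm hq, WithLp.toLp_add]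
  exact norm_add_le _ _

lemma lqNorm_smul (hq : 1 ≤ q) {t : ℝ} (ht : 0 ≤ t) (v : Fin d → ℝ) :
    lqNorm q (t • v) = t * lqNorm q v := by
  have : Fact (1 ≤ q) := ⟨hq⟩
  simp only [lqNorm_eq_norm hq, WithLp.toLp_smul]
  rw [norm_smul, Real.norm_of_nonneg ht]

lemma lqNorm_mono (hq : 1 ≤ q) {v w : Fin d → ℝ} (h : ∀ i, |v i| ≤ |w i|) :
    lqNorm q v ≤ lqNorm q w := by
  unfold lqNorm
  split_ifs with hqt
  · exact ciSup_mono (Set.finite_range _).bddAbove h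
  · have : 0 < q.toReal := ENNReal.toReal_pos (by positivity) hqt
    refine Real.rpow_le_rpow (by positivity) (Finset.sum_le_sum fun i _ => ?_) (by positivity)
    exact Real.rpow_le_rpow (abs_nonneg _) (h i) this.le

lemma exists_lqNorm_le (hq : 1 ≤ q) :
    ∃ C : ℝ, 0 ≤ C ∧ ∀ v : Rd d, lqNorm q v.ofLp ≤ C * ‖v‖ := by
  have : Fact (1 ≤ q) := ⟨hq⟩
  let L : Rd d →ₗ[ℝ] PiLp q (fun _ : Fin d => ℝ) :=
    (WithLp.linearEquiv q ℝ (Fin d → ℝ)).symm.toLinearMap ∘ₗ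
      (WithLp.linearEquiv 2 ℝ (Fin d → ℝ)).toLinearMap
  refine ⟨‖L.toContinuousLinearMap‖, norm_nonneg _, fun v => ?_⟩
  rw [lqNorm_eq_norm hq]
  exact L.toContinuousLinearMap.le_opNorm v

/-- The `ℓ^q` norm of the coordinatewise positive part. -/
noncomputable def posPartNorm (q : ℝ≥0∞) {d : ℕ} (v : Rd d) : ℝ := lqNorm q (fun i => max (v i) 0)

lemma posPartNorm_nonneg (hq : 1 ≤ q) (v : Rd d) : 0 ≤ posPartNorm q v := lqNorm_nonneg hq _

lemma posPartNorm_mono (hq : 1 ≤ q) {v w : Rd d} (h : ∀ i, v i ≤ w i) :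
    posPartNorm q v ≤ posPartNorm q w := by
  refine lqNorm_mono hq fun i => ?_
  rw [abs_of_nonneg (le_max_right _ _), abs_of_nonneg (le_max_right _ _)]
  exact max_le_max_right _ (h i)

lemma posPartNorm_add_le (hq : 1 ≤ q) (v w : Rd d) :
    posPartNorm q (v + w) ≤ posPartNorm q v + posPartNorm q w := by
  refine le_trans (lqNorm_mono hq fun i => ?_) (lqNorm_add_le hq _ _)
  simp only [Pi.add_apply, PiLp.add_apply]
  rw [abs_of_nonneg (le_max_right _ _), abs_of_nonneg (by positivity)]
  exact max_le (add_le_add (le_max_left _ _) (le_max_left _ _)) (by positivity)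

lemma posPartNorm_smul (hq : 1 ≤ q) {t : ℝ} (ht : 0 ≤ t) (v : Rd d) :
    posPartNorm q (t • v) = t * posPartNorm q v := by
  unfold posPartNorm
  rw [← lqNorm_smul hq ht]
  congr 1
  ext i
  simp [mul_max_of_nonneg _ _ ht]

lemma posPartNorm_le_lqNorm (hq : 1 ≤ q) (v : Rd d) : posPartNorm q v ≤ lqNorm q v.ofLp :=
  lqNorm_mono hq fun i => by
    rw [abs_of_nonneg (le_max_right _ _)]
    exact max_le (le_abs_self _) (abs_nonneg _)

lemma posPartNorm_sub_le (hq : 1 ≤ q) (v w : Rd d) :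
    posPartNorm q v - posPartNorm q w ≤ lqNorm q (v - w).ofLp := by
  have h := posPartNorm_add_le hq (v - w) w
  rw [sub_add_cancel] at h
  linarith [posPartNorm_le_lqNorm hq (v - w)]

lemma continuous_of_sub_le_lqNorm (hq : 1 ≤ q) {f : Rd d → ℝ}
    (hf : ∀ y z, f y - f z ≤ lqNorm q (y - z).ofLp) : Continuous f := by
  obtain ⟨C, hC0, hC⟩ := exists_lqNorm_le (d := d) hq
  refine (LipschitzWith.of_dist_le_mul (K := ⟨C, hC0⟩) fun y z => ?_).continuous
  rw [Real.dist_eq, dist_eq_norm]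
  refine abs_sub_le_iff.2 ⟨(hf y z).trans (hC _), (hf z y).trans ?_⟩
  rw [norm_sub_rev]
  exact hC _

lemma continuous_posPartNorm (hq : 1 ≤ q) : Continuous (posPartNorm q (d := d)) :=
  continuous_of_sub_le_lqNorm hq (posPartNorm_sub_le hq)

lemma lqNorm_sub_comm (hq : 1 ≤ q) (y z : Rd d) :
    lqNorm q (y - z).ofLp = lqNorm q (z - y).ofLp :=
  le_antisymm (lqNorm_mono hq fun i => by simp [abs_sub_comm])
    (lqNorm_mono hq fun i => by simp [abs_sub_comm])

end LqNorm

section FiniteDuality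

variable {d : ℕ} {ι κ : Type*} [Fintype ι] [Fintype κ]

open scoped Pointwise in
/-- Separating the set of achievable (second marginal, cost) pairs from `(n, T)` yields a
multiplier for the second marginal constraint. -/
lemma exists_multiplier {c : Rd d → ℝ} (hcont : Continuous c)
    (hadd : ∀ v w, c (v + w) ≤ c v + c w) (hsmul : ∀ t : ℝ, 0 ≤ t → ∀ v, c (t • v) = t * c v)
    {m : ι → ℝ} (hm : m ∈ stdSimplex ℝ ι) {n : κ → ℝ} (hn : n ∈ stdSimplex ℝ κ)
    (a : ι → Rd d) (b : κ → Rd d) {T : ℝ}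
    (hT : ∀ l : ι → κ → ℝ, (∀ i, l i ∈ stdSimplex ℝ κ) → (∀ j, ∑ i, m i * l i j = n j) →
      T < ∑ i, m i * c (a i - ∑ j, l i j • b j)) :
    ∃ g : κ → ℝ, ∀ l : ι → κ → ℝ, (∀ i, l i ∈ stdSimplex ℝ κ) →
      T ≤ (∑ i, m i * (c (a i - ∑ j, l i j • b j) + ∑ j, l i j * g j)) - ∑ j, n j * g j := by
  classical
  set F : (ι → κ → ℝ) → ℝ := fun l => ∑ i, m i * c (a i - ∑ j, l i j • b j) with hF
  set P : (ι → κ → ℝ) → κ → ℝ := fun l j => ∑ i, m i * l i j with hP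
  set K : Set (ι → κ → ℝ) := Set.univ.pi fun _ => stdSimplex ℝ κ with hK
  have hKc : IsCompact K := isCompact_univ_pi fun _ => isCompact_stdSimplex ℝ κ
  have hKconv : Convex ℝ K := convex_pi fun _ _ => convex_stdSimplex ℝ κ
  have hFc : Continuous F := by fun_prop
  have hPc : Continuous P := by fun_prop
  have hFconv : ∀ l l' : ι → κ → ℝ, ∀ s t : ℝ, 0 ≤ s → 0 ≤ t → s + t = 1 →
      F (s • l + t • l') ≤ s * F l + t * F l' := by
    intro l l' s t hs ht hst
    simp only [hF, Finset.mul_sum, ← Finset.sum_add_distrib]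
    refine Finset.sum_le_sum fun i _ => ?_
    have h1 : a i - ∑ j, (s • l + t • l') i j • b j
        = s • (a i - ∑ j, l i j • b j) + t • (a i - ∑ j, l' i j • b j) := by
      simp only [Pi.add_apply, Pi.smul_apply, smul_eq_mul, add_smul, mul_smul,
        Finset.sum_add_distrib, ← Finset.smul_sum, smul_sub]
      nth_rewrite 1 [← one_smul ℝ (a i), ← hst]
      rw [add_smul]
      abel
    rw [h1]
    have h2 := hadd (s • (a i - ∑ j, l i j • b j)) (t • (a i - ∑ j, l' i j • b j))
    rw [hsmul s hs, hsmul t ht] at h2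
    nlinarith [mul_le_mul_of_nonneg_left h2 (hm.1 i)]
  set A : Set ((κ → ℝ) × ℝ) := {z | ∃ l ∈ K, z.1 = P l ∧ F l ≤ z.2} with hA
  have hAconv : Convex ℝ A := by
    rintro ⟨u, x⟩ ⟨l, hl, h1, h2⟩ ⟨u', x'⟩ ⟨l', hl', h1', h2'⟩ s t hs ht hst
    refine ⟨s • l + t • l', hKconv hl hl' hs ht hst, ?_, ?_⟩
    · simp only at h1 h1'
      subst h1 h1'
      ext j
      simp only [hP, Prod.smul_mk, Prod.mk_add_mk, Pi.add_apply, Pi.smul_apply, smul_eq_mul,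
        Finset.mul_sum, ← Finset.sum_add_distrib]
      exact Finset.sum_congr rfl fun i _ => by ring
    · refine (hFconv l l' s t hs ht hst).trans ?_
      simp only [Prod.smul_mk, Prod.mk_add_mk, smul_eq_mul]
      gcongr
  have hAclosed : IsClosed A := by
    have h1 : A = (fun l => (P l, F l)) '' K + ({0} : Set (κ → ℝ)) ×ˢ Set.Ici (0 : ℝ) := by
      ext ⟨u, x⟩
      simp only [hA, Set.mem_ofPred_eq, Set.mem_add, Set.mem_image, Set.mem_prod]
      constructor
      · rintro ⟨l, hl, h1, h2⟩
        exact ⟨_, ⟨l, hl, rfl⟩, (0, x - F l), ⟨rfl, sub_nonneg.2 h2⟩, by simp [h1]⟩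
      · rintro ⟨_, ⟨l, hl, rfl⟩, ⟨w, y⟩, ⟨hw, hy⟩, h⟩
        simp only [Set.mem_singleton_iff] at hw
        subst hw
        simp only [Prod.mk_add_mk, add_zero, Prod.mk.injEq] at h
        exact ⟨l, hl, h.1.symm, by rw [← h.2]; simpa using hy⟩
    rw [h1]
    exact (isClosed_singleton.prod isClosed_Ici).add_left_of_isCompact
      (hKc.image (hPc.prodMk hFc))
  have hnot : (n, T) ∉ A := by
    rintro ⟨l, hl, h1, h2⟩
    refine (hT l (fun i => hl i trivial) fun j => (congrFun h1 j).symm).not_ge h2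
  obtain ⟨f, u, hfu, hfA⟩ := geometric_hahn_banach_point_closed hAconv hAclosed hnot
  set s : ℝ := f (0, 1) with hs
  have hsplit : ∀ (w : κ → ℝ) (t : ℝ), f (w, t) = f (w, 0) + t * s := by
    intro w t
    have : (w, t) = (w, (0 : ℝ)) + t • ((0 : κ → ℝ), (1 : ℝ)) := by simp
    rw [this, map_add, map_smul, smul_eq_mul]
  set G : κ → ℝ := fun j => f (Pi.single j 1, 0) with hG
  have hlin : ∀ w : κ → ℝ, f (w, 0) = ∑ j, w j * G j := by
    intro w
    have : f (w, 0) = (f.comp (ContinuousLinearMap.inl ℝ (κ → ℝ) ℝ)) w := rfl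
    rw [this]
    conv_lhs => rw [pi_eq_sum_univ' w]
    simp [map_sum, hG]
  have hspos : 0 < s := by
    have hl0 : (fun _ : ι => n) ∈ K := fun _ _ => hn
    have hP0 : P (fun _ => n) = n := by
      ext j
      simp [hP, ← Finset.sum_mul, hm.2]
    have h1 := hfA (n, F fun _ => n) ⟨_, hl0, hP0.symm, le_rfl⟩
    have h2 := hfu.trans h1
    rw [hsplit, hsplit n (F _)] at h2
    have h3 := hT (fun _ => n) (fun _ => hn) (congrFun hP0)
    change T < F fun _ => n at h3
    nlinarith
  refine ⟨fun j => G j / s, fun l hl => ?_⟩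
  have h1 := hfu.trans (hfA (P l, F l) ⟨l, fun i _ => hl i, rfl, le_rfl⟩)
  rw [hsplit, hsplit (P l), hlin, hlin] at h1
  have h2 : (∑ i, m i * (c (a i - ∑ j, l i j • b j) + ∑ j, l i j * (G j / s)))
      = F l + (∑ j, P l j * G j) / s := by
    simp only [mul_add, Finset.sum_add_distrib, hF, hP, Finset.sum_mul, Finset.sum_div,
      Finset.mul_sum]
    rw [Finset.sum_comm (γ := κ)]
    congr 1
    exact Finset.sum_congr rfl fun j _ => Finset.sum_congr rfl fun i _ => by ring
  have h3 : ∑ j, n j * (G j / s) = (∑ j, n j * G j) / s := by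
    rw [Finset.sum_div]
    exact Finset.sum_congr rfl fun j _ => by ring
  rw [h2, h3, add_sub_assoc, ← sub_div, ← sub_le_iff_le_add', le_div_iff₀ hspos]
  linarith

lemma exists_convex_potential {q : ℝ≥0∞} (hq : 1 ≤ q) {m : ι → ℝ} (hm : m ∈ stdSimplex ℝ ι)
    {n : κ → ℝ} (hn : n ∈ stdSimplex ℝ κ) (a : ι → Rd d) (b : κ → Rd d) {T : ℝ}
    (hT : ∀ l : ι → κ → ℝ, (∀ i, l i ∈ stdSimplex ℝ κ) → (∀ j, ∑ i, m i * l i j = n j) →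
      T < ∑ i, m i * posPartNorm q (a i - ∑ j, l i j • b j)) :
    ∃ ψ : Rd d → ℝ, ConvexOn ℝ Set.univ ψ ∧ CoordMono ψ ∧
      (∀ y z : Rd d, |ψ y - ψ z| ≤ lqNorm q (y - z).ofLp) ∧
      T ≤ (∑ i, m i * ψ (a i)) - ∑ j, n j * ψ (b j) := by
  classical
  obtain ⟨g, hg⟩ := exists_multiplier (continuous_posPartNorm hq) (posPartNorm_add_le hq)
    (fun t ht v => posPartNorm_smul hq ht v) hm hn a b hT
  let H : Rd d → (κ → ℝ) → ℝ := fun x l => posPartNorm q (x - ∑ j, l j • b j) + ∑ j, l j * g j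
  have hmin : ∀ x, ∃ l ∈ stdSimplex ℝ κ, ∀ l' ∈ stdSimplex ℝ κ, H x l ≤ H x l' := by
    intro x
    have hc : Continuous (H x) := by
      have := continuous_posPartNorm (d := d) hq
      fun_prop
    obtain ⟨l, hl, h⟩ := (isCompact_stdSimplex ℝ κ).exists_isMinOn ⟨n, hn⟩ hc.continuousOn
    exact ⟨l, hl, fun l' hl' => h hl'⟩
  choose L hL hLmin using hmin
  have hlip : ∀ y z, H y (L y) - H z (L z) ≤ lqNorm q (y - z).ofLp := by
    intro y z
    have h1 := hLmin y (L z) (hL z)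
    have h2 := posPartNorm_sub_le hq (y - ∑ j, L z j • b j) (z - ∑ j, L z j • b j)
    rw [sub_sub_sub_cancel_right] at h2
    simp only [H] at h1 ⊢
    linarith
  refine ⟨fun x => H x (L x), ⟨convex_univ, ?_⟩, ?_, ?_, ?_⟩
  · intro x _ y _ s t hs ht hst
    refine (hLmin _ _ (convex_stdSimplex ℝ κ (hL x) (hL y) hs ht hst)).trans ?_
    have h1 : s • x + t • y - ∑ j, (s • L x + t • L y) j • b j
        = s • (x - ∑ j, L x j • b j) + t • (y - ∑ j, L y j • b j) := by
      simp only [Pi.add_apply, Pi.smul_apply, smul_eq_mul, add_smul, mul_smul,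
        Finset.sum_add_distrib, ← Finset.smul_sum, smul_sub]
      abel
    have h2 := posPartNorm_add_le hq (s • (x - ∑ j, L x j • b j)) (t • (y - ∑ j, L y j • b j))
    rw [posPartNorm_smul hq hs, posPartNorm_smul hq ht] at h2
    have h3 : ∑ j, (s • L x + t • L y) j * g j = s * ∑ j, L x j * g j + t * ∑ j, L y j * g j := by
      simp only [Pi.add_apply, Pi.smul_apply, smul_eq_mul, Finset.mul_sum,
        ← Finset.sum_add_distrib]
      exact Finset.sum_congr rfl fun j _ => by ring
    simp only [H, h1, h3, smul_eq_mul]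
    linarith
  · intro y z h
    refine (hLmin y _ (hL z)).trans (add_le_add_left (posPartNorm_mono hq fun i => ?_) _)
    simpa using h i
  · intro y z
    refine abs_sub_le_iff.2 ⟨hlip y z, ?_⟩
    rw [lqNorm_sub_comm hq]
    exact hlip z y
  · refine (hg (fun i => L (a i)) fun i => hL _).trans (sub_le_sub_left ?_ _)
    refine Finset.sum_le_sum fun j _ => mul_le_mul_of_nonneg_left ?_ (hn.1 j)
    refine (hLmin (b j) (Pi.single j 1) (single_mem_stdSimplex ℝ j)).trans ?_
    have h0 : posPartNorm q (0 : Rd d) = 0 := by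
      simpa using posPartNorm_smul hq le_rfl (0 : Rd d)
    simp [H, Pi.single_apply, ite_smul, h0]

end FiniteDuality

section Discretization

open scoped ProbabilityTheory

variable {d : ℕ}

lemma HasMomentP.integrable_id {ρ : Measure (Rd d)} (h : HasMomentP 1 ρ) :
    Integrable (fun y => y) ρ := by
  refine ⟨aestronglyMeasurable_id, ?_⟩
  rw [HasFiniteIntegral, lt_top_iff_ne_top]
  simpa [HasMomentP, Real.rpow_one, ofReal_norm] using h

lemma exists_discretization {ρ : Measure (Rd d)} (h : Integrable (fun y => y) ρ) {ε : ℝ}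
    (hε : 0 < ε) : ∃ (k : ℕ) (σ : Rd d → Fin k) (a : Fin k → Rd d), Measurable σ ∧
      Integrable (fun x => a (σ x)) ρ ∧ ∫ x, ‖x - a (σ x)‖ ∂ρ ≤ ε := by
  obtain ⟨s, hs, hsm⟩ := (memLp_one_iff_integrable.2 h).exists_simpleFunc_eLpNorm_sub_lt
    ENNReal.one_ne_top (ENNReal.ofReal_pos.2 hε).ne'
  let e := s.range.equivFin
  have key : ∀ x, ((e.symm (e ⟨s x, s.mem_range_self x⟩) : s.range) : Rd d) = s x := by simp
  refine ⟨s.range.card, fun x => e ⟨s x, s.mem_range_self x⟩, fun i => (e.symm i : Rd d),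
    ?_, ?_, ?_⟩
  · have : Measurable fun x => (⟨s x, s.mem_range_self x⟩ : s.range) :=
      s.measurable.subtype_mk
    exact (measurable_of_finite e).comp this
  · simpa only [key] using memLp_one_iff_integrable.1 hsm
  · simp only [key]
    have hdiff : Integrable (fun x => x - s x) ρ := h.sub (memLp_one_iff_integrable.1 hsm)
    rw [← ENNReal.ofReal_le_ofReal_iff hε.le, ofReal_integral_norm_eq_lintegral_enorm hdiff,
      ← eLpNorm_one_eq_lintegral_enorm]
    exact hs.le

lemma integral_comp_fintype {Ω ι : Type*} [MeasurableSpace Ω] [Fintype ι] [MeasurableSpace ι]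
    [MeasurableSingletonClass ι] {μ : Measure Ω} [IsFiniteMeasure μ] {σ : Ω → ι}
    (hσ : Measurable σ) (f : ι → ℝ) :
    ∫ x, f (σ x) ∂μ = ∑ i, μ.real (σ ⁻¹' {i}) * f i := by
  rw [← integral_map hσ.aemeasurable (measurable_of_finite f).aestronglyMeasurable,
    integral_fintype .of_finite]
  simp [map_measureReal_apply hσ (measurableSet_singleton _)]

lemma measureReal_fibers_mem_stdSimplex {Ω ι : Type*} [MeasurableSpace Ω] [Fintype ι]
    [MeasurableSpace ι] [MeasurableSingletonClass ι] {μ : Measure Ω} [IsProbabilityMeasure μ]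
    {σ : Ω → ι} (hσ : Measurable σ) :
    (fun i => μ.real (σ ⁻¹' {i})) ∈ stdSimplex ℝ ι :=
  ⟨fun _ => measureReal_nonneg, by simpa using (integral_comp_fintype (μ := μ) hσ fun _ => 1).symm⟩

lemma disint_compProd_ae_eq {X : Type*} [MeasurableSpace X] (μ : Measure X)
    [IsProbabilityMeasure μ] (η : ProbabilityTheory.Kernel X (Rd d))
    [ProbabilityTheory.IsMarkovKernel η] :
    ∀ᵐ x ∂μ, disint (μ ⊗ₘ η) x = η x := by
  have h := ProbabilityTheory.eq_condKernel_of_measure_eq_compProd (ρ := μ ⊗ₘ η) η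
    (by rw [Measure.fst_compProd])
  rw [Measure.fst_compProd] at h
  filter_upwards [h] with x hx
  rw [disint, dif_pos (inferInstance : IsFiniteMeasure (μ ⊗ₘ η)), hx]

/-- A measure disintegrated along a map to a finite type, with probability measures as fibres,
including over null points. -/
lemma exists_fiber_measures {ι : Type*} [Fintype ι] [MeasurableSpace ι]
    [MeasurableSingletonClass ι] {ν : Measure (Rd d)} [IsProbabilityMeasure ν]
    {τ : Rd d → ι} (hτ : Measurable τ) :
    ∃ ρ : ι → Measure (Rd d), (∀ j, IsProbabilityMeasure (ρ j)) ∧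
      (∑ j, ν (τ ⁻¹' {j}) • ρ j = ν) ∧
      (∀ f : Rd d → Rd d, Integrable f ν → ∀ j, Integrable f (ρ j)) ∧
      (∀ j, ν (τ ⁻¹' {j}) ≠ 0 → ∀ᵐ y ∂ρ j, τ y = j) := by
  classical
  refine ⟨fun j => if ν (τ ⁻¹' {j}) = 0 then ν else ProbabilityTheory.cond ν (τ ⁻¹' {j}),
    fun j => ?_, ?_, fun f hf j => ?_, fun j hj => ?_⟩
  · dsimp only
    split_ifs with h
    · infer_instance
    · exact ProbabilityTheory.cond_isProbabilityMeasure h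
  · conv_rhs => rw [← ProbabilityTheory.sum_meas_smul_cond_fiber hτ ν]
    refine Finset.sum_congr rfl fun j _ => ?_
    dsimp only
    split_ifs with h
    · simp [h]
    · rfl
  · dsimp only
    split_ifs with h
    · exact hf
    · exact hf.restrict.smul_measure (ENNReal.inv_ne_top.2 h)
  · simp only [if_neg hj]
    exact ProbabilityTheory.ae_cond_mem (hτ (measurableSet_singleton j))

lemma exists_coupling_cost_le {q : ℝ≥0∞} (hq : 1 ≤ q) {μ ν : Measure (Rd d)}
    [IsProbabilityMeasure μ] [IsProbabilityMeasure ν]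
    (hμ : Integrable (fun y => y) μ) (hν : Integrable (fun y => y) ν) {C : ℝ} (hC0 : 0 ≤ C)
    (hC : ∀ v : Rd d, lqNorm q v.ofLp ≤ C * ‖v‖) {k k' : ℕ} {σ : Rd d → Fin k}
    (hσ : Measurable σ) {τ : Rd d → Fin k'} (hτ : Measurable τ) {a : Fin k → Rd d}
    (ha : Integrable (fun x => a (σ x)) μ) {b : Fin k' → Rd d}
    (hb : Integrable (fun x => b (τ x)) ν) {l : Fin k → Fin k' → ℝ}
    (hl : ∀ i, l i ∈ stdSimplex ℝ (Fin k'))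
    (hln : ∀ j, ∑ i, μ.real (σ ⁻¹' {i}) * l i j = ν.real (τ ⁻¹' {j})) :
    ∃ π : Measure (Rd d × Rd d), IsCoupling π μ ν ∧
      ∫⁻ x, ENNReal.ofReal (posPartNorm q (x - ∫ y, y ∂(disint π x))) ∂μ ≤
        ENNReal.ofReal ((∑ i, μ.real (σ ⁻¹' {i}) * posPartNorm q (a i - ∑ j, l i j • b j)) +
          C * ∫ x, ‖x - a (σ x)‖ ∂μ + C * ∫ y, ‖y - b (τ y)‖ ∂ν) := by
  obtain ⟨ρ, hρ, hρν, hρint, hρτ⟩ := exists_fiber_measures (ν := ν) hτ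
  let η₀ : Fin k → Measure (Rd d) := fun i => ∑ j, ENNReal.ofReal (l i j) • ρ j
  have hη₀ : ∀ i, IsProbabilityMeasure (η₀ i) := fun i => ⟨by
    simp only [η₀, Measure.coe_finsetSum, Finset.sum_apply, Measure.smul_apply, measure_univ,
      smul_eq_mul, mul_one]
    rw [← ENNReal.ofReal_sum_of_nonneg fun j _ => (hl i).1 j, (hl i).2, ENNReal.ofReal_one]⟩
  let η : ProbabilityTheory.Kernel (Rd d) (Rd d) :=
    ⟨fun x => η₀ (σ x), (measurable_of_finite η₀).comp hσ⟩
  have hη : ProbabilityTheory.IsMarkovKernel η := ⟨fun x => hη₀ (σ x)⟩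
  have hnl : ∀ j, ∑ i, ENNReal.ofReal (l i j) * μ (σ ⁻¹' {i}) = ν (τ ⁻¹' {j}) := by
    intro j
    rw [← ofReal_measureReal (μ := ν), ← hln j, ENNReal.ofReal_sum_of_nonneg
      fun i _ => mul_nonneg measureReal_nonneg ((hl i).1 j)]
    refine Finset.sum_congr rfl fun i _ => ?_
    rw [ENNReal.ofReal_mul measureReal_nonneg, ofReal_measureReal, mul_comm]
  have hsnd : (μ ⊗ₘ η).snd = ν := by
    rw [Measure.snd_compProd]
    ext B hB
    rw [Measure.bind_apply hB η.aemeasurable]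
    have hlin := lintegral_map (μ := μ) (measurable_of_finite fun i => η₀ i B) hσ
    refine hlin.symm.trans ?_
    rw [lintegral_fintype]
    conv_rhs => rw [← hρν]
    simp only [η₀, Measure.coe_finsetSum, Finset.sum_apply, Measure.smul_apply, smul_eq_mul,
      Measure.map_apply hσ (measurableSet_singleton _), ← hnl, Finset.sum_mul]
    rw [Finset.sum_comm]
    exact Finset.sum_congr rfl fun j _ => Finset.sum_congr rfl fun i _ => by ring
  refine ⟨μ ⊗ₘ η, ⟨inferInstance, Measure.fst_compProd μ η, hsnd⟩, ?_⟩
  have hmean : ∀ i, ∫ y, y ∂(η₀ i) = ∑ j, l i j • ∫ y, y ∂(ρ j) := by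
    intro i
    rw [integral_finsetSum_measure fun j _ =>
      (hρint _ hν j).smul_measure ENNReal.ofReal_ne_top]
    refine Finset.sum_congr rfl fun j _ => ?_
    rw [integral_smul_measure, ENNReal.toReal_ofReal ((hl i).1 j)]
  set e : Fin k' → ℝ := fun j => ∫ y, ‖y - b j‖ ∂(ρ j) with he
  have he0 : ∀ j, 0 ≤ e j := fun j => integral_nonneg fun _ => norm_nonneg _
  have hbar : ∀ j, ‖b j - ∫ y, y ∂(ρ j)‖ ≤ e j := by
    intro j
    have h : (∫ y, y ∂(ρ j)) - b j = ∫ y, (y - b j) ∂(ρ j) := by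
      rw [integral_sub (hρint _ hν j) (integrable_const _)]
      simp
    rw [norm_sub_rev, h]
    exact norm_integral_le_integral_norm _
  have hesum : ∑ j, ν.real (τ ⁻¹' {j}) * e j = ∫ y, ‖y - b (τ y)‖ ∂ν := by
    have hdiff : Integrable (fun y => y - b (τ y)) ν := hν.sub hb
    conv_rhs => rw [← hρν]
    rw [integral_finsetSum_measure fun j _ =>
      ((hρint _ hdiff j).norm).smul_measure (measure_ne_top _ _)]
    refine Finset.sum_congr rfl fun j _ => ?_
    rw [integral_smul_measure, smul_eq_mul, measureReal_def]
    by_cases hj : ν (τ ⁻¹' {j}) = 0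
    · simp [hj]
    · congr 1
      refine integral_congr_ae ?_
      filter_upwards [hρτ j hj] with y hy
      rw [hy]
  set G : Fin k → ℝ := fun i => posPartNorm q (a i - ∑ j, l i j • b j) + C * ∑ j, l i j * e j
    with hG
  have hG0 : ∀ i, 0 ≤ G i := fun i => add_nonneg (posPartNorm_nonneg hq _)
    (mul_nonneg hC0 (Finset.sum_nonneg fun j _ => mul_nonneg ((hl i).1 j) (he0 j)))
  have hpt : ∀ x, posPartNorm q (x - ∫ y, y ∂(η₀ (σ x))) ≤ C * ‖x - a (σ x)‖ + G (σ x) := by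
    intro x
    rw [hmean]
    set i := σ x
    have h1 : x - ∑ j, l i j • ∫ y, y ∂(ρ j) =
        ((x - a i) + (a i - ∑ j, l i j • b j)) + ∑ j, l i j • (b j - ∫ y, y ∂(ρ j)) := by
      simp only [smul_sub, Finset.sum_sub_distrib]
      abel
    have h2 : ‖∑ j, l i j • (b j - ∫ y, y ∂(ρ j))‖ ≤ ∑ j, l i j * e j := by
      refine norm_sum_le_of_le _ fun j _ => ?_
      rw [norm_smul, Real.norm_of_nonneg ((hl i).1 j)]
      exact mul_le_mul_of_nonneg_left (hbar j) ((hl i).1 j)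
    have h3 : ∀ v : Rd d, posPartNorm q v ≤ C * ‖v‖ := fun v =>
      (posPartNorm_le_lqNorm hq v).trans (hC v)
    rw [h1]
    have h4 := posPartNorm_add_le hq (x - a i + (a i - ∑ j, l i j • b j))
      (∑ j, l i j • (b j - ∫ y, y ∂(ρ j)))
    have h5 := posPartNorm_add_le hq (x - a i) (a i - ∑ j, l i j • b j)
    have h6 := (h3 (∑ j, l i j • (b j - ∫ y, y ∂(ρ j)))).trans
      (mul_le_mul_of_nonneg_left h2 hC0)
    have h7 := h3 (x - a i)
    simp only [hG]
    linarith
  have hint1 : Integrable (fun x => C * ‖x - a (σ x)‖) μ := ((hμ.sub ha).norm).const_mul C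
  have hint2 : Integrable (fun x => G (σ x)) μ :=
    (Integrable.of_finite (μ := μ.map σ) (f := G)).comp_measurable hσ
  calc ∫⁻ x, ENNReal.ofReal (posPartNorm q (x - ∫ y, y ∂(disint (μ ⊗ₘ η) x))) ∂μ
      ≤ ∫⁻ x, ENNReal.ofReal (C * ‖x - a (σ x)‖ + G (σ x)) ∂μ := by
        refine lintegral_mono_ae ?_
        filter_upwards [disint_compProd_ae_eq μ η] with x hx
        rw [hx]
        exact ENNReal.ofReal_le_ofReal (hpt x)
    _ = ENNReal.ofReal (∫ x, (C * ‖x - a (σ x)‖ + G (σ x)) ∂μ) :=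
        (ofReal_integral_eq_lintegral_ofReal (hint1.add hint2)
          (.of_forall fun x => add_nonneg (by positivity) (hG0 _))).symm
    _ = _ := by
        congr 1
        rw [integral_add hint1 hint2, integral_const_mul, integral_comp_fintype hσ, ← hesum]
        simp only [hG, ← hln, mul_add, Finset.sum_add_distrib, Finset.mul_sum, Finset.sum_mul]
        rw [Finset.sum_comm (γ := Fin k)]
        have : ∑ j, ∑ i, μ.real (σ ⁻¹' {i}) * (C * (l i j * e j))
            = ∑ j, ∑ i, C * (μ.real (σ ⁻¹' {i}) * l i j * e j) :=
          Finset.sum_congr rfl fun j _ => Finset.sum_congr rfl fun i _ => by ring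
        rw [this]
        ring

end Discretization

section Duality

variable {d : ℕ} {q : ℝ≥0∞}

lemma integrable_of_lqNorm_lipschitz (hq : 1 ≤ q) {ρ : Measure (Rd d)} [IsProbabilityMeasure ρ]
    (hρ : Integrable (fun y => y) ρ) {ψ : Rd d → ℝ}
    (hψ : ∀ y z, |ψ y - ψ z| ≤ lqNorm q (y - z).ofLp) : Integrable ψ ρ := by
  obtain ⟨C, hC0, hC⟩ := exists_lqNorm_le (d := d) hq
  have hcont := continuous_of_sub_le_lqNorm hq fun y z => (le_abs_self _).trans (hψ y z)
  refine ((integrable_const |ψ 0|).add (hρ.norm.const_mul C)).mono'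
    hcont.aestronglyMeasurable (.of_forall fun y => ?_)
  have h1 := (hψ y 0).trans (hC _)
  rw [sub_zero] at h1
  have h2 := abs_sub_abs_le_abs_sub (ψ y) (ψ 0)
  simp only [Pi.add_apply, Real.norm_eq_abs]
  linarith

lemma sub_le_posPartNorm {ψ : Rd d → ℝ} (hmono : CoordMono ψ)
    (hψ : ∀ y z, |ψ y - ψ z| ≤ lqNorm q (y - z).ofLp) (x m : Rd d) :
    ψ x - ψ m ≤ posPartNorm q (x - m) := by
  let p : Rd d := WithLp.toLp 2 fun i => max ((x - m) i) 0
  have h1 : ψ x ≤ ψ (m + p) := hmono _ _ fun i => by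
    have : x i - m i ≤ max (x i - m i) 0 := le_max_left _ _
    simp only [p, PiLp.add_apply, PiLp.sub_apply]
    linarith
  have h2 := (le_abs_self _).trans (hψ (m + p) m)
  rw [add_sub_cancel_left] at h2
  exact (sub_le_sub_right h1 _).trans h2

lemma ofReal_integral_le_lintegral {Ω : Type*} [MeasurableSpace Ω] {μ : Measure Ω} {f : Ω → ℝ}
    (hf : Integrable f μ) :
    ENNReal.ofReal (∫ x, f x ∂μ) ≤ ∫⁻ x, ENNReal.ofReal (f x) ∂μ := by
  rw [integral_eq_lintegral_pos_part_sub_lintegral_neg_part hf]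
  exact (ENNReal.ofReal_le_ofReal (sub_le_self _ ENNReal.toReal_nonneg)).trans
    ENNReal.ofReal_toReal_le

/-- Weak duality. -/
lemma ofReal_integral_sub_le_cost (hq : 1 ≤ q) {μ ν : Measure (Rd d)} [IsProbabilityMeasure μ]
    [IsProbabilityMeasure ν] (hμ : Integrable (fun y => y) μ) (hν : Integrable (fun y => y) ν)
    {π : Measure (Rd d × Rd d)} (hπ : IsCoupling π μ ν) {ψ : Rd d → ℝ}
    (hconv : ConvexOn ℝ Set.univ ψ) (hmono : CoordMono ψ)
    (hψ : ∀ y z, |ψ y - ψ z| ≤ lqNorm q (y - z).ofLp) :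
    ENNReal.ofReal ((∫ y, ψ y ∂μ) - ∫ y, ψ y ∂ν) ≤
      ∫⁻ x, ENNReal.ofReal (posPartNorm q (x - ∫ y, y ∂(disint π x))) ∂μ := by
  obtain ⟨hπp, hfst, hsnd⟩ := hπ
  have hfst' : π.fst = μ := hfst
  have hdis : disint π = π.condKernel := by
    rw [disint, dif_pos (inferInstance : IsFiniteMeasure π)]
  have hcont := continuous_of_sub_le_lqNorm hq fun y z => (le_abs_self _).trans (hψ y z)
  have hψμ := integrable_of_lqNorm_lipschitz hq hμ hψ
  have hψν := integrable_of_lqNorm_lipschitz hq hν hψ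
  have hid2 : Integrable (fun z : Rd d × Rd d => z.2) π := by
    rw [← hsnd] at hν
    exact hν.comp_measurable measurable_snd
  have hψ2 : Integrable (fun z : Rd d × Rd d => ψ z.2) π := by
    rw [← hsnd] at hψν
    exact hψν.comp_measurable measurable_snd
  have hν_eq : ∫ y, ψ y ∂ν = ∫ x, ∫ y, ψ y ∂(π.condKernel x) ∂μ := by
    rw [← hsnd, integral_map measurable_snd.aemeasurable hcont.aestronglyMeasurable,
      ← Measure.integral_condKernel hψ2, hfst']
  have hcond := hψ2.integral_condKernel
  have hae1 := hψ2.condKernel_ae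
  have hae2 := hid2.condKernel_ae
  rw [hfst'] at hcond hae1 hae2
  rw [hν_eq, ← integral_sub hψμ hcond]
  refine (ofReal_integral_le_lintegral (hψμ.sub hcond)).trans (lintegral_mono_ae ?_)
  filter_upwards [hae1, hae2] with x h1 h2
  refine ENNReal.ofReal_le_ofReal ?_
  have hJ := hconv.map_integral_le hcont.continuousOn isClosed_univ (.of_forall fun _ => trivial)
    h2 h1
  have h3 := sub_le_posPartNorm hmono hψ x (∫ y, y ∂(π.condKernel x))
  rw [hdis, Pi.sub_apply]
  linarith

/-- Strong duality, up to an arbitrarily small error. -/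
lemma exists_potential_of_lt_cost (hq : 1 ≤ q) {μ ν : Measure (Rd d)} [IsProbabilityMeasure μ]
    [IsProbabilityMeasure ν] (hμ : Integrable (fun y => y) μ) (hν : Integrable (fun y => y) ν)
    {T ε : ℝ} (hε : 0 < ε)
    (hT : ∀ π : Measure (Rd d × Rd d), IsCoupling π μ ν → ENNReal.ofReal T <
      ∫⁻ x, ENNReal.ofReal (posPartNorm q (x - ∫ y, y ∂(disint π x))) ∂μ) :
    ∃ ψ : Rd d → ℝ, ConvexOn ℝ Set.univ ψ ∧ CoordMono ψ ∧
      (∀ y z : Rd d, |ψ y - ψ z| ≤ lqNorm q (y - z).ofLp) ∧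
      T - ε ≤ (∫ y, ψ y ∂μ) - ∫ y, ψ y ∂ν := by
  obtain ⟨C, hC0, hC⟩ := exists_lqNorm_le (d := d) hq
  have hδ : 0 < ε / (4 * (C + 1)) := by positivity
  have hCδ : C * (ε / (4 * (C + 1))) ≤ ε / 4 := by
    rw [mul_div_assoc', div_le_div_iff₀ (by positivity) (by positivity)]
    nlinarith
  obtain ⟨k, σ, a, hσ, ha, hσa⟩ := exists_discretization hμ hδ
  obtain ⟨k', τ, b, hτ, hb, hτb⟩ := exists_discretization hν hδ
  have hA := (mul_le_mul_of_nonneg_left hσa hC0).trans hCδ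
  have hB := (mul_le_mul_of_nonneg_left hτb hC0).trans hCδ
  obtain ⟨ψ, hconv, hmono, hlip, hψ⟩ := exists_convex_potential (T := T - ε / 2) hq
    (measureReal_fibers_mem_stdSimplex (μ := μ) hσ)
    (measureReal_fibers_mem_stdSimplex (μ := ν) hτ) a b (by
      intro l hl hln
      obtain ⟨π, hπ, hcost⟩ := exists_coupling_cost_le hq hμ hν hC0 hC hσ hτ ha hb hl hln
      have h2 := lt_of_not_ge fun h' =>
        ((hT π hπ).trans_le hcost).not_ge (ENNReal.ofReal_le_ofReal h')
      linarith)
  refine ⟨ψ, hconv, hmono, hlip, ?_⟩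
  have happrox : ∀ (ρ : Measure (Rd d)) [IsProbabilityMeasure ρ],
      Integrable (fun y => y) ρ → ∀ {n : ℕ} {s : Rd d → Fin n} {c : Fin n → Rd d},
      Measurable s → Integrable (fun y => c (s y)) ρ →
      |(∫ y, ψ y ∂ρ) - ∑ i, ρ.real (s ⁻¹' {i}) * ψ (c i)| ≤ C * ∫ y, ‖y - c (s y)‖ ∂ρ := by
    intro ρ _ hρ n s c hs hc
    have hi := integrable_of_lqNorm_lipschitz hq hρ hlip
    have hi' : Integrable (fun y => ψ (c (s y))) ρ :=
      (Integrable.of_finite (μ := ρ.map s) (f := fun i => ψ (c i))).comp_measurable hs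
    rw [← integral_comp_fintype hs (fun i => ψ (c i)), ← integral_sub hi hi',
      ← integral_const_mul]
    have hdiff : Integrable (fun y => C * ‖y - c (s y)‖) ρ := (hρ.sub hc).norm.const_mul C
    exact norm_integral_le_of_norm_le (f := fun y => ψ y - ψ (c (s y))) hdiff
      (.of_forall fun y => (hlip y (c (s y))).trans (hC _))
  have h1 := abs_le.1 (happrox μ hμ hσ ha)
  have h2 := abs_le.1 (happrox ν hν hτ hb)
  linarith [h1.1, h2.2]

end Duality

/-- **Increasing convex Kantorovich–Rubinstein formula**: for `q ∈ [1,∞]` and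
`μ, ν ∈ P₁(ℝ^d)`,
`inf_π ∫ ‖(x - mean π_x)₊‖_q dμ = sup { μ(ψ) - ν(ψ) }` where the supremum runs over
convex, coordinatewise increasing functions `ψ` that are `1`-Lipschitz for `‖·‖_q`. -/
theorem increasing_convex_kantorovich_rubinstein {d : ℕ}
    (q : ℝ≥0∞) (hq : 1 ≤ q) (μ ν : Measure (Rd d))
    (hμ : IsProbabilityMeasure μ) (hν : IsProbabilityMeasure ν)
    (hμ1 : HasMomentP 1 μ) (hν1 : HasMomentP 1 ν) :
    ((⨅ π : {π : Measure (Rd d × Rd d) // IsCoupling π μ ν},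
        ∫⁻ x, ENNReal.ofReal
          (lqNorm q (fun i => max ((x - ∫ y, y ∂(disint π.1 x)) i) 0)) ∂μ : ℝ≥0∞) : EReal)
      = ⨆ ψ : {ψ : Rd d → ℝ // ConvexOn ℝ Set.univ ψ ∧ CoordMono ψ ∧
            ∀ y z : Rd d, |ψ y - ψ z| ≤ lqNorm q (fun i => y i - z i)},
          (((∫ y, ψ.1 y ∂μ) - ∫ y, ψ.1 y ∂ν : ℝ) : EReal) := by
  have hμi := hμ1.integrable_id
  have hνi := hν1.integrable_id
  refine le_antisymm ?_ (iSup_le fun ⟨ψ, hconv, hmono, hlip⟩ => ?_)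
  · refine EReal.le_of_forall_lt_iff_le.1 fun T hST => ?_
    by_contra! hTI
    have hpos : 0 ≤ T := by
      have h0 := (le_iSup (fun ψ : {ψ : Rd d → ℝ // ConvexOn ℝ Set.univ ψ ∧ CoordMono ψ ∧
        ∀ y z : Rd d, |ψ y - ψ z| ≤ lqNorm q (fun i => y i - z i)} =>
          (((∫ y, ψ.1 y ∂μ) - ∫ y, ψ.1 y ∂ν : ℝ) : EReal))
        ⟨fun _ => 0, convexOn_const 0 convex_univ, fun _ _ _ => le_rfl,
          fun _ _ => by simpa using lqNorm_nonneg hq _⟩).trans hST.le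
      simpa using h0
    obtain ⟨r, hSr, hrT⟩ := EReal.lt_iff_exists_real_btwn.1 hST
    obtain ⟨ψ, hconv, hmono, hlip, hψ⟩ := exists_potential_of_lt_cost hq hμi hνi
      (sub_pos.2 (EReal.coe_lt_coe_iff.1 hrT)) (fun π hπ => by
        rw [← EReal.coe_ennreal_lt_coe_ennreal_iff, EReal.coe_ennreal_ofReal, max_eq_left hpos]
        exact hTI.trans_le (EReal.coe_ennreal_le_coe_ennreal_iff.2
          (iInf_le_of_le (⟨π, hπ⟩ : {π // IsCoupling π μ ν}) le_rfl)))
    rw [sub_sub_cancel] at hψ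
    exact hSr.not_ge ((EReal.coe_le_coe_iff.2 hψ).trans
      (le_iSup_of_le ⟨ψ, hconv, hmono, hlip⟩ le_rfl))
  · refine le_trans ?_ (EReal.coe_ennreal_le_coe_ennreal_iff.2 <| le_iInf fun ⟨π, hπ⟩ =>
      ofReal_integral_sub_le_cost hq hμi hνi hπ hconv hmono hlip)
    rw [EReal.coe_ennreal_ofReal]
    exact EReal.coe_le_coe_iff.2 (le_max_left _ _)
end
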